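/- Fix δ > 0, λ ≥ 0, A > 0 and set I₁ = (−4A/5, −3A/5), I₂ = (−2A/5, −A/5), I₃ = (A/5, 2A/5), I₄ = (3A/5, 4A/5). Assume λ > 0, or λ = 0 and δ ≥ 1. There exist constants C₀ > 0, C, c, γ > 0 and ε₀ ∈ (0,1), depending only on (δ, λ, A), such that for every n (with m = δn), every s ∈ {−1,+1}^m, and every ε ∈ (0, ε₀): P[ min { P(x; 1) : ‖x‖∞ ≤ A and for some k ∈ {1,2,3,4}, #{i : x_i ∈ I_k} < C₀·n } ≤ φ(τ*, β*; 1, A) + γ·ε³ ] ≤ (C/ε³)·exp(−c n ε⁶), where the minimum over an empty set is +∞ and the probability is over H. -/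

import Mathlib

open MeasureTheory ProbabilityTheory Real
open scoped ENNReal NNReal

/-- The deterministic scalar function `φ(τ, β; ρ, A)`. -/
noncomputable def phiFn (δ lam ρ A τ β : ℝ) : ℝ :=
  τ * β * δ / 2 + ρ * β / (2 * τ) - β ^ 2 / 4 +
    ∫ h : ℝ,
      sInf ((fun x : ℝ => β / (2 * τ) * x ^ 2 + lam * x ^ 2 - β * h * x) '' Set.Icc (-A) A)
      ∂(gaussianReal 0 1)

/-- `(τs, βs)` is a saddle point of `max_{β ≥ 0} min_{τ > 0} φ(τ, β; ρ, A)`. -/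
def IsSaddle (δ lam ρ A τs βs : ℝ) : Prop :=
  0 < τs ∧ 0 < βs ∧
    (∀ τ : ℝ, 0 < τ → phiFn δ lam ρ A τs βs ≤ phiFn δ lam ρ A τ βs) ∧
    (∀ β : ℝ, 0 ≤ β → phiFn δ lam ρ A τs β ≤ phiFn δ lam ρ A τs βs)

/-- Law of an `m × n` random matrix with i.i.d. centered Gaussian entries of variance `1/n`. -/
noncomputable def matMeasure (m n : ℕ) : Measure (Fin m → Fin n → ℝ) :=
  Measure.pi fun _ : Fin m => Measure.pi fun _ : Fin n => gaussianReal 0 ((n : ℝ≥0))⁻¹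

/-- Matrix–vector product. -/
noncomputable def mulV {m n : ℕ} (H : Fin m → Fin n → ℝ) (x : Fin n → ℝ) : Fin m → ℝ :=
  fun k => ∑ i, H k i * x i

/-- The precoding cost `P(x; 1) = (1/n)‖Hx − s‖² + (λ/n)‖x‖²`. -/
noncomputable def cost1 (m n : ℕ) (lam : ℝ) (s : Fin m → ℝ)
    (H : Fin m → Fin n → ℝ) (x : Fin n → ℝ) : ℝ :=
  (∑ k, (mulV H x k - s k) ^ 2) / n + lam * (∑ i, (x i) ^ 2) / n

/-- The standard Gaussian measure on `I → ℝ`. -/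
noncomputable abbrev gaussPi (I : Type*) [Fintype I] : Measure (I → ℝ) :=
  Measure.pi fun _ : I => gaussianReal 0 1

lemma hasDerivAt_gaussianPDFReal_std (x : ℝ) :
    HasDerivAt (gaussianPDFReal 0 1) (-(x * gaussianPDFReal 0 1 x)) x := by
  have h : HasDerivAt (fun y : ℝ => -(y - 0) ^ 2 / (2 * ((1 : ℝ≥0) : ℝ))) (-x) x := by
    have := (((hasDerivAt_id x).sub_const 0).pow 2).neg.div_const (2 * ((1 : ℝ≥0) : ℝ))
    refine this.congr_deriv ?_
    simp
    try ring
  have h2 := h.exp.const_mul ((√(2 * π * ((1 : ℝ≥0) : ℝ)))⁻¹)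
  refine (h2.congr_deriv ?_).congr_of_eventuallyEq (Filter.Eventually.of_forall fun y => ?_)
  · simp only [gaussianPDFReal]; ring
  · simp only [gaussianPDFReal]

lemma integrable_id_gaussianReal : Integrable (fun x : ℝ => x) (gaussianReal 0 1) :=
  (memLp_id_gaussianReal (μ := 0) (v := 1) 1).integrable le_rfl

lemma integral_mul_gaussianReal {g g' : ℝ → ℝ} {C : ℝ} (hg : ∀ x, HasDerivAt g (g' x) x)
    (hb : ∀ x, |g x| ≤ C) (hb' : ∀ x, |g' x| ≤ C) :
    ∫ x, x * g x ∂(gaussianReal 0 1) = ∫ x, g' x ∂(gaussianReal 0 1) := by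
  have hgc : Continuous g := continuous_iff_continuousAt.2 fun x => (hg x).continuousAt
  have hgm : Measurable g' := by
    have : g' = deriv g := funext fun x => (hg x).deriv.symm
    rw [this]; exact measurable_deriv g
  have hpdf : Integrable (gaussianPDFReal 0 1) := integrable_gaussianPDFReal 0 1
  have hxpdf : Integrable (fun x => x * gaussianPDFReal 0 1 x) := by
    have h1 := integrable_id_gaussianReal
    rw [gaussianReal_of_var_ne_zero 0 one_ne_zero,
      integrable_withDensity_iff (measurable_gaussianPDF 0 1) (by simp [gaussianPDF])] at h1
    simpa [toReal_gaussianPDF] using h1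
  have key := integral_mul_deriv_eq_deriv_mul_of_integrable (u := g) (v := gaussianPDFReal 0 1)
    (u' := g') (v' := fun x => -(x * gaussianPDFReal 0 1 x)) (fun x _ => hg x)
    (fun x _ => hasDerivAt_gaussianPDFReal_std x)
    (hxpdf.neg.bdd_mul hgc.aestronglyMeasurable (Filter.Eventually.of_forall hb))
    (hpdf.bdd_mul hgm.aestronglyMeasurable (Filter.Eventually.of_forall hb'))
    (hpdf.bdd_mul hgc.aestronglyMeasurable (Filter.Eventually.of_forall hb))
  rw [integral_gaussianReal_eq_integral_smul one_ne_zero,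
    integral_gaussianReal_eq_integral_smul one_ne_zero]
  simp only [smul_eq_mul]
  have e1 : ∫ x, gaussianPDFReal 0 1 x * (x * g x) =
      - ∫ x, g x * -(x * gaussianPDFReal 0 1 x) := by
    rw [← integral_neg]; congr 1; ext x; ring
  rw [e1, key, neg_neg]
  congr 1; ext x; ring

lemma measurePreserving_update {I : Type*} [Fintype I] [DecidableEq I] {E : I → Type*}
    [∀ i, MeasurableSpace (E i)] (μ : ∀ i, Measure (E i)) [∀ i, IsProbabilityMeasure (μ i)]
    (i : I) :
    MeasurePreserving (fun p : (∀ j, E j) × E i => Function.update p.1 i p.2)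
      ((Measure.pi μ).prod (μ i)) (Measure.pi μ) := by
  have hm : Measurable (fun p : (∀ j, E j) × E i => Function.update p.1 i p.2) := by
    rw [measurable_pi_iff]
    intro j
    by_cases hj : j = i
    · subst hj; simpa using measurable_snd
    · simp only [Function.update_of_ne hj]; fun_prop
  refine ⟨hm, (Measure.pi_eq fun s hs => ?_).symm⟩
  rw [Measure.map_apply hm (MeasurableSet.univ_pi hs)]
  have : (fun p : (∀ j, E j) × E i => Function.update p.1 i p.2) ⁻¹' Set.univ.pi s
      = (Set.univ.pi (Function.update s i Set.univ)) ×ˢ s i := by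
    ext p
    simp only [Set.mem_preimage, Set.mem_pi, Set.mem_univ, true_imp_iff, Set.mem_prod]
    constructor
    · intro h
      refine ⟨fun j => ?_, by simpa using h i⟩
      by_cases hj : j = i
      · subst hj; simp
      · simpa [Function.update_of_ne hj] using h j
    · rintro ⟨h1, h2⟩ j
      by_cases hj : j = i
      · subst hj; simpa using h2
      · simpa [Function.update_of_ne hj] using h1 j
  rw [this, Measure.prod_prod, Measure.pi_pi, ← Finset.prod_erase_mul _ _ (Finset.mem_univ i),
    ← Finset.prod_erase_mul Finset.univ (fun j => μ j (s j)) (Finset.mem_univ i)]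
  simp only [Function.update_self, measure_univ, mul_one]
  congr 1
  refine Finset.prod_congr rfl fun j hj => ?_
  rw [Function.update_of_ne (Finset.ne_of_mem_erase hj)]

lemma integrable_eval_gaussPi {I : Type*} [Fintype I] (i : I) :
    Integrable (fun w : I → ℝ => w i) (gaussPi I) :=
  (measurePreserving_eval (fun _ : I => gaussianReal 0 1) i).integrable_comp_of_integrable
    (g := fun x : ℝ => x) integrable_id_gaussianReal

lemma integrable_of_bounded {Ω : Type*} [MeasurableSpace Ω] {μ : Measure Ω} [IsFiniteMeasure μ]
    {f : Ω → ℝ} (hf : Measurable f) {C : ℝ} (hC : ∀ x, |f x| ≤ C) : Integrable f μ :=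
  Integrable.of_bound hf.aestronglyMeasurable C (Filter.Eventually.of_forall hC)

/-- Gaussian integration by parts. -/
lemma integral_eval_mul_gaussPi {I : Type*} [Fintype I] [DecidableEq I] (i : I)
    {G G' : (I → ℝ) → ℝ} {C : ℝ} (hGm : Measurable G) (hGm' : Measurable G')
    (hG : ∀ w, HasDerivAt (fun t => G (Function.update w i t)) (G' w) (w i))
    (hb : ∀ w, |G w| ≤ C) (hb' : ∀ w, |G' w| ≤ C) :
    ∫ w, w i * G w ∂(gaussPi I) = ∫ w, G' w ∂(gaussPi I) := by
  have mp : MeasurePreserving (fun p : (I → ℝ) × ℝ => Function.update p.1 i p.2)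
      ((gaussPi I).prod (gaussianReal 0 1)) (gaussPi I) :=
    measurePreserving_update (fun _ : I => gaussianReal 0 1) i
  have h1 : Integrable (fun w : I → ℝ => w i * G w) (gaussPi I) :=
    (integrable_eval_gaussPi i).mul_bdd hGm.aestronglyMeasurable (Filter.Eventually.of_forall hb)
  have h2 : Integrable G' (gaussPi I) := integrable_of_bounded hGm' hb'
  have e : ∀ {f : (I → ℝ) → ℝ}, Measurable f → Integrable f (gaussPi I) →
      ∫ w, f w ∂(gaussPi I) =
        ∫ w, ∫ t, f (Function.update w i t) ∂(gaussianReal 0 1) ∂(gaussPi I) := by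
    intro f hfm hf
    have hf' := mp.integrable_comp_of_integrable hf
    rw [← integral_prod (fun p : (I → ℝ) × ℝ => f (Function.update p.1 i p.2)) hf']
    conv_lhs => rw [← mp.map_eq]
    exact integral_map mp.measurable.aemeasurable hfm.aestronglyMeasurable
  rw [e (f := fun w => w i * G w) ((measurable_pi_apply i).mul hGm) h1, e hGm' h2]
  congr 1
  ext w
  simp only [Function.update_self]
  refine integral_mul_gaussianReal (C := C) (fun t => ?_) (fun t => hb _) (fun t => hb' _)
  simpa using hG (Function.update w i t)

/-- Gaussian interpolation: two centred Gaussian vectors `A w`, `B w` built from independent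
blocks of coordinates are compared through the signs of the second derivatives of `F`. -/
lemma integral_gaussPi_le_of_interpolation {I K : Type*} [Fintype I] [Fintype K] [DecidableEq I]
    (A B : K → I → ℝ) (hAB : ∀ k l, ∑ i, A k i * B l i = 0)
    (F : (K → ℝ) → ℝ) (F1 : K → (K → ℝ) → ℝ) (F2 : K → K → (K → ℝ) → ℝ)
    (hFc : Continuous F) (hF1c : ∀ k, Continuous (F1 k)) (hF2c : ∀ k l, Continuous (F2 k l))
    (hF : ∀ (z : ℝ → K → ℝ) (z' : K → ℝ) (t : ℝ), (∀ k, HasDerivAt (fun r => z r k) (z' k) t) →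
      HasDerivAt (fun r => F (z r)) (∑ k, F1 k (z t) * z' k) t)
    (hF1 : ∀ (k : K) (z : ℝ → K → ℝ) (z' : K → ℝ) (t : ℝ),
      (∀ l, HasDerivAt (fun r => z r l) (z' l) t) →
      HasDerivAt (fun r => F1 k (z r)) (∑ l, F2 k l (z t) * z' l) t)
    {C : ℝ} (hFb : ∀ z, |F z| ≤ C) (hF1b : ∀ k z, |F1 k z| ≤ C) (hF2b : ∀ k l z, |F2 k l z| ≤ C)
    (hpos : ∀ z, 0 ≤ ∑ k, ∑ l,
      (∑ i, A k i * A l i - ∑ i, B k i * B l i) * F2 k l z) :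
    ∫ w, F (fun k => ∑ i, B k i * w i) ∂(gaussPi I) ≤
      ∫ w, F (fun k => ∑ i, A k i * w i) ∂(gaussPi I) := by
  have hC : 0 ≤ C := (abs_nonneg _).trans (hFb 0)
  set M : ℝ → K → I → ℝ := fun θ k i => sin θ * A k i + cos θ * B k i with hM
  set M' : ℝ → K → I → ℝ := fun θ k i => cos θ * A k i - sin θ * B k i with hM'
  set Z : ℝ → (I → ℝ) → K → ℝ := fun θ w k => ∑ i, M θ k i * w i with hZ
  set Z' : ℝ → (I → ℝ) → K → ℝ := fun θ w k => ∑ i, M' θ k i * w i with hZ'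
  have hZc : ∀ θ, Continuous (Z θ) := fun θ => by fun_prop
  have hZ'c : ∀ θ, Continuous (Z' θ) := fun θ => by fun_prop
  have hZd : ∀ θ w k, HasDerivAt (fun r => Z r w k) (Z' θ w k) θ := by
    intro θ w k
    refine HasDerivAt.fun_sum fun i _ => ?_
    refine HasDerivAt.mul_const ?_ _
    have := ((hasDerivAt_sin θ).mul_const (A k i)).add ((hasDerivAt_cos θ).mul_const (B k i))
    refine this.congr_deriv ?_
    simp only [hM']; ring
  set bound : (I → ℝ) → ℝ := fun w => ∑ k, C * ∑ i, (|A k i| + |B k i|) * |w i| with hbound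
  have hbi : Integrable bound (gaussPi I) := by
    refine integrable_finsetSum _ fun k _ => Integrable.const_mul ?_ _
    exact integrable_finsetSum _ fun i _ => (integrable_eval_gaussPi i).abs.const_mul _
  have hder : ∀ θ, HasDerivAt (fun r => ∫ w, F (Z r w) ∂(gaussPi I))
      (∫ w, ∑ k, F1 k (Z θ w) * Z' θ w k ∂(gaussPi I)) θ := by
    intro θ
    refine (hasDerivAt_integral_of_dominated_loc_of_deriv_le (bound := bound)
      (F := fun r w => F (Z r w)) (F' := fun r w => ∑ k, F1 k (Z r w) * Z' r w k)
      (s := Set.univ) Filter.univ_mem ?_ ?_ ?_ ?_ hbi ?_).2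
    · exact Filter.Eventually.of_forall fun r => (hFc.comp (hZc r)).aestronglyMeasurable
    · exact integrable_of_bounded (hFc.comp (hZc θ)).measurable fun w => hFb _
    · refine Continuous.aestronglyMeasurable ?_
      refine continuous_finsetSum _ fun k _ => ((hF1c k).comp (hZc θ)).mul ?_
      exact (continuous_apply k).comp (hZ'c θ)
    · refine Filter.Eventually.of_forall fun w r _ => ?_
      rw [Real.norm_eq_abs]
      refine (Finset.abs_sum_le_sum_abs _ _).trans (Finset.sum_le_sum fun k _ => ?_)
      rw [abs_mul]
      refine mul_le_mul (hF1b _ _) ?_ (abs_nonneg _) hC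
      refine (Finset.abs_sum_le_sum_abs _ _).trans (Finset.sum_le_sum fun i _ => ?_)
      rw [abs_mul]
      refine mul_le_mul_of_nonneg_right ?_ (abs_nonneg _)
      refine (abs_sub _ _).trans ?_
      rw [abs_mul, abs_mul]
      nlinarith [abs_cos_le_one r, abs_sin_le_one r, abs_nonneg (A k i), abs_nonneg (B k i)]
    · exact Filter.Eventually.of_forall fun w r _ => hF _ _ _ (hZd r w)
  have hibp : ∀ θ k i, ∫ w, w i * F1 k (Z θ w) ∂(gaussPi I) =
      ∫ w, ∑ l, F2 k l (Z θ w) * M θ l i ∂(gaussPi I) := by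
    intro θ k i
    have hs : 0 ≤ ∑ l, C * |M θ l i| := Finset.sum_nonneg fun l _ => by positivity
    refine integral_eval_mul_gaussPi (C := C + ∑ l, C * |M θ l i|) i
      ((hF1c k).comp (hZc θ)).measurable ?_ (fun w => ?_) (fun w => ?_) (fun w => ?_)
    · refine Continuous.measurable ?_
      exact continuous_finsetSum _ fun l _ => ((hF2c k l).comp (hZc θ)).mul continuous_const
    · have := hF1 k (fun t => Z θ (Function.update w i t)) (fun l => M θ l i) (w i) (fun l => ?_)
      · simpa using this
      · have h := HasDerivAt.fun_sum (u := Finset.univ)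
          (A := fun j t => M θ l j * Function.update w i t j)
          (A' := fun j => M θ l j * if j = i then 1 else 0) (x := w i) (fun j _ => ?_)
        · simpa using h
        · refine HasDerivAt.const_mul _ ?_
          by_cases hj : j = i
          · subst hj; simpa using hasDerivAt_id' (w j)
          · simpa [Function.update_of_ne hj, hj] using hasDerivAt_const (w i) (w j)
    · exact (hF1b _ _).trans (by linarith)
    · refine (Finset.abs_sum_le_sum_abs _ _).trans (le_trans (Finset.sum_le_sum fun l _ => ?_)
        (le_add_of_nonneg_left hC))
      rw [abs_mul]
      exact mul_le_mul_of_nonneg_right (hF2b _ _ _) (abs_nonneg _)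
  have hF1i : ∀ θ k i, Integrable (fun w => M' θ k i * (w i * F1 k (Z θ w))) (gaussPi I) :=
    fun θ k i => ((integrable_eval_gaussPi i).mul_bdd
      ((hF1c k).comp (hZc θ)).aestronglyMeasurable
      (Filter.Eventually.of_forall fun w => hF1b _ _)).const_mul _
  have hF2i : ∀ θ k i, Integrable (fun w => ∑ l, F2 k l (Z θ w) * M θ l i) (gaussPi I) :=
    fun θ k i => integrable_finsetSum _ fun l _ =>
      (integrable_of_bounded ((hF2c k l).comp (hZc θ)).measurable fun w => hF2b _ _ _).mul_const _
  have hval : ∀ θ, ∫ w, ∑ k, F1 k (Z θ w) * Z' θ w k ∂(gaussPi I) =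
      sin θ * cos θ * ∫ w, ∑ k, ∑ l,
        (∑ i, A k i * A l i - ∑ i, B k i * B l i) * F2 k l (Z θ w) ∂(gaussPi I) := by
    intro θ
    have e1 : ∀ w, ∑ k, F1 k (Z θ w) * Z' θ w k =
        ∑ k, ∑ i, M' θ k i * (w i * F1 k (Z θ w)) := by
      intro w
      refine Finset.sum_congr rfl fun k _ => ?_
      rw [hZ', Finset.mul_sum]
      exact Finset.sum_congr rfl fun i _ => by ring
    simp only [e1]
    rw [integral_finsetSum _ fun k _ => integrable_finsetSum _ fun i _ => hF1i θ k i]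
    simp_rw [integral_finsetSum _ fun i _ => hF1i θ _ i, integral_const_mul, hibp,
      ← integral_const_mul]
    rw [Finset.sum_congr rfl fun k _ => (integral_finsetSum Finset.univ
      fun i _ => (hF2i θ k i).const_mul (M' θ k i)).symm]
    rw [← integral_finsetSum _ fun k _ => integrable_finsetSum _
      fun i _ => (hF2i θ k i).const_mul (M' θ k i)]
    congr 1
    ext w
    rw [Finset.mul_sum]
    refine Finset.sum_congr rfl fun k _ => ?_
    simp_rw [Finset.mul_sum]
    rw [Finset.sum_comm]
    refine Finset.sum_congr rfl fun l _ => ?_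
    have e2 : ∑ i, M' θ k i * M θ l i =
        sin θ * cos θ * (∑ i, A k i * A l i - ∑ i, B k i * B l i) := by
      have : ∀ i, M' θ k i * M θ l i = sin θ * cos θ * (A k i * A l i) -
          sin θ * cos θ * (B k i * B l i) + cos θ ^ 2 * (A k i * B l i)
          - sin θ ^ 2 * (A l i * B k i) := fun i => by simp only [hM, hM']; ring
      simp_rw [this, Finset.sum_sub_distrib, Finset.sum_add_distrib, Finset.sum_sub_distrib,
        ← Finset.mul_sum, hAB]
      ring
    rw [← mul_assoc, ← e2, Finset.sum_mul]
    exact Finset.sum_congr rfl fun i _ => by ring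
  have hmono : MonotoneOn (fun r => ∫ w, F (Z r w) ∂(gaussPi I)) (Set.Icc 0 (π / 2)) := by
    refine monotoneOn_of_deriv_nonneg (convex_Icc _ _)
      (fun θ _ => (hder θ).continuousAt.continuousWithinAt)
      (fun θ _ => (hder θ).differentiableAt.differentiableWithinAt) fun θ hθ => ?_
    rw [interior_Icc] at hθ
    rw [(hder θ).deriv, hval]
    refine mul_nonneg (mul_nonneg ?_ ?_) (integral_nonneg fun w => hpos _)
    · exact sin_nonneg_of_nonneg_of_le_pi hθ.1.le (by linarith [hθ.2, pi_pos])
    · exact cos_nonneg_of_neg_pi_div_two_le_of_le (by linarith [hθ.1, pi_pos]) hθ.2.le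
  have h := hmono (Set.left_mem_Icc.2 (by positivity)) (Set.right_mem_Icc.2 (by positivity))
    (by positivity : (0 : ℝ) ≤ π / 2)
  simpa [hZ, hM] using h

section SmoothedNorm

variable {m : ℕ}

/-- The Euclidean distance to `s`, smoothed at scale `κ`. -/
noncomputable def smoothDist (κ : ℝ) (s : Fin m → ℝ) (v : Option (Fin m) → ℝ) : ℝ :=
  √(κ ^ 2 + ∑ k, (v (some k) - s k) ^ 2)

/-- Smoothed distance to `s` in the `some` coordinates plus the `none` coordinate. -/
noncomputable def shiftedDist (κ : ℝ) (s : Fin m → ℝ) (v : Option (Fin m) → ℝ) : ℝ :=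
  smoothDist κ s v + v none

/-- First partial derivatives of `shiftedDist`. -/
noncomputable def shiftedDistD (κ : ℝ) (s : Fin m → ℝ) :
    Option (Fin m) → (Option (Fin m) → ℝ) → ℝ
  | none, _ => 1
  | some k, v => (v (some k) - s k) / smoothDist κ s v

/-- Second partial derivatives of `shiftedDist`. -/
noncomputable def shiftedDistDD (κ : ℝ) (s : Fin m → ℝ) :
    Option (Fin m) → Option (Fin m) → (Option (Fin m) → ℝ) → ℝ
  | some k, some l, v => (if k = l then 1 else 0) / smoothDist κ s v -
      (v (some k) - s k) * (v (some l) - s l) / smoothDist κ s v ^ 3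
  | _, _, _ => 0

variable {κ : ℝ} (s : Fin m → ℝ)

lemma continuous_smoothDist : Continuous (smoothDist κ s) := by
  unfold smoothDist; fun_prop

lemma le_smoothDist (v : Option (Fin m) → ℝ) : κ ≤ smoothDist κ s v := by
  refine le_sqrt_of_sq_le ?_
  linarith [Finset.sum_nonneg fun (k : Fin m) (_ : k ∈ Finset.univ) =>
    sq_nonneg (v (some k) - s k)]

lemma abs_sub_le_smoothDist (v : Option (Fin m) → ℝ) (k : Fin m) :
    |v (some k) - s k| ≤ smoothDist κ s v := by
  refine abs_le_sqrt ?_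
  have := Finset.single_le_sum (f := fun k => (v (some k) - s k) ^ 2)
    (fun _ _ => sq_nonneg _) (Finset.mem_univ k)
  nlinarith [sq_nonneg κ]

lemma continuous_shiftedDist : Continuous (shiftedDist κ s) :=
  (continuous_smoothDist s).add (continuous_apply none)

lemma smoothDist_arg_pos (hκ : 0 < κ) (v : Option (Fin m) → ℝ) :
    0 < κ ^ 2 + ∑ k, (v (some k) - s k) ^ 2 :=
  add_pos_of_pos_of_nonneg (by positivity) (Finset.sum_nonneg fun _ _ => sq_nonneg _)

lemma smoothDist_pos (hκ : 0 < κ) (v : Option (Fin m) → ℝ) : 0 < smoothDist κ s v :=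
  sqrt_pos.2 (smoothDist_arg_pos s hκ v)

lemma smoothDist_sq (hκ : 0 < κ) (v : Option (Fin m) → ℝ) :
    smoothDist κ s v ^ 2 = κ ^ 2 + ∑ k, (v (some k) - s k) ^ 2 :=
  sq_sqrt (smoothDist_arg_pos s hκ v).le

lemma hasDerivAt_smoothDist (hκ : 0 < κ) {v : ℝ → Option (Fin m) → ℝ}
    {v' : Option (Fin m) → ℝ} {t : ℝ}
    (hv : ∀ o, HasDerivAt (fun r => v r o) (v' o) t) :
    HasDerivAt (fun r => smoothDist κ s (v r))
      (∑ k, (v t (some k) - s k) / smoothDist κ s (v t) * v' (some k)) t := by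
  have h1 : HasDerivAt (fun r => κ ^ 2 + ∑ k, (v r (some k) - s k) ^ 2)
      (∑ k, 2 * (v t (some k) - s k) * v' (some k)) t := by
    refine HasDerivAt.const_add _ (HasDerivAt.fun_sum fun k _ => ?_)
    refine (((hv (some k)).sub_const (s k)).fun_pow 2).congr_deriv ?_
    simp
  refine (h1.sqrt (smoothDist_arg_pos s hκ _).ne').congr_deriv ?_
  rw [Finset.sum_div]
  refine Finset.sum_congr rfl fun k _ => ?_
  have := (smoothDist_pos s hκ (v t)).ne'
  change _ / (2 * smoothDist κ s (v t)) = _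
  field_simp

lemma hasDerivAt_shiftedDist (hκ : 0 < κ) {v : ℝ → Option (Fin m) → ℝ}
    {v' : Option (Fin m) → ℝ} {t : ℝ}
    (hv : ∀ o, HasDerivAt (fun r => v r o) (v' o) t) :
    HasDerivAt (fun r => shiftedDist κ s (v r)) (∑ o, shiftedDistD κ s o (v t) * v' o) t := by
  refine ((hasDerivAt_smoothDist s hκ hv).add (hv none)).congr_deriv ?_
  simp [Fintype.sum_option, shiftedDistD, add_comm]

lemma hasDerivAt_shiftedDistD (hκ : 0 < κ) (o : Option (Fin m)) {v : ℝ → Option (Fin m) → ℝ}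
    {v' : Option (Fin m) → ℝ} {t : ℝ} (hv : ∀ o, HasDerivAt (fun r => v r o) (v' o) t) :
    HasDerivAt (fun r => shiftedDistD κ s o (v r))
      (∑ p, shiftedDistDD κ s o p (v t) * v' p) t := by
  rcases o with _ | k
  · simpa [shiftedDistD, shiftedDistDD] using hasDerivAt_const t (1 : ℝ)
  · have hr := (smoothDist_pos s hκ (v t)).ne'
    refine (((hv (some k)).sub_const (s k)).div (hasDerivAt_smoothDist s hκ hv) hr).congr_deriv ?_
    have e : ∀ l, shiftedDistDD κ s (some k) (some l) (v t) * v' (some l) =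
        (if k = l then v' (some l) / smoothDist κ s (v t) else 0) -
          (v t (some k) - s k) / smoothDist κ s (v t) ^ 2 *
            ((v t (some l) - s l) / smoothDist κ s (v t) * v' (some l)) := by
      intro l
      rw [shiftedDistDD]
      split_ifs <;> field_simp
      ring
    rw [Fintype.sum_option]
    simp_rw [e, Finset.sum_sub_distrib, ← Finset.mul_sum]
    rw [Finset.sum_ite_eq, if_pos (Finset.mem_univ _)]
    simp only [shiftedDistDD, zero_mul, zero_add]
    field_simp

lemma continuous_shiftedDistD (hκ : 0 < κ) (o : Option (Fin m)) : Continuous (shiftedDistD κ s o) := by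
  rcases o with _ | k
  · exact continuous_const
  · exact (by fun_prop : Continuous fun v : Option (Fin m) → ℝ => v (some k) - s k).div
      (continuous_smoothDist s) fun v => (smoothDist_pos s hκ v).ne'

lemma continuous_shiftedDistDD (hκ : 0 < κ) (o p : Option (Fin m)) :
    Continuous (shiftedDistDD κ s o p) := by
  rcases o with _ | k <;> rcases p with _ | l
  iterate 3 exact continuous_const
  exact (continuous_const.div (continuous_smoothDist s)
    fun v => (smoothDist_pos s hκ v).ne').sub
    ((by fun_prop : Continuous fun v : Option (Fin m) → ℝ =>
      (v (some k) - s k) * (v (some l) - s l)).div ((continuous_smoothDist s).pow 3)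
      fun v => (pow_pos (smoothDist_pos s hκ v) 3).ne')

lemma abs_shiftedDistD_le (hκ : 0 < κ) (o : Option (Fin m)) (v : Option (Fin m) → ℝ) :
    |shiftedDistD κ s o v| ≤ 1 := by
  rcases o with _ | k
  · simp [shiftedDistD]
  · have := smoothDist_pos s hκ v
    rw [shiftedDistD, abs_div, abs_of_pos this, div_le_one this]
    exact abs_sub_le_smoothDist s v k

lemma abs_shiftedDistDD_le (hκ : 0 < κ) (o p : Option (Fin m)) (v : Option (Fin m) → ℝ) :
    |shiftedDistDD κ s o p v| ≤ 2 / κ := by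
  have h0 : (0 : ℝ) ≤ 2 / κ := by positivity
  rcases o with _ | k <;> rcases p with _ | l
  iterate 3 simpa [shiftedDistDD] using h0
  have hr := smoothDist_pos s hκ v
  have h1 := one_div_le_one_div_of_le hκ (le_smoothDist s v)
  have h2 : |(if k = l then (1 : ℝ) else 0) / smoothDist κ s v| ≤ 1 / smoothDist κ s v := by
    rw [abs_div, abs_of_pos hr]
    gcongr
    split_ifs <;> simp
  have h3 : |(v (some k) - s k) * (v (some l) - s l) / smoothDist κ s v ^ 3| ≤
      1 / smoothDist κ s v := by
    rw [abs_div, abs_mul, abs_of_pos (pow_pos hr 3), div_le_div_iff₀ (pow_pos hr 3) hr]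
    have := mul_le_mul (abs_sub_le_smoothDist (κ := κ) s v k) (abs_sub_le_smoothDist (κ := κ) s v l)
      (abs_nonneg _) hr.le
    nlinarith
  rw [shiftedDistDD]
  refine (abs_sub _ _).trans ?_
  have : 2 / κ = 1 / κ + 1 / κ := by ring
  linarith

lemma sum_shiftedDistD_mul_le (hκ : 0 < κ) (v w : Option (Fin m) → ℝ) :
    ∑ k, shiftedDistD κ s (some k) v * shiftedDistD κ s (some k) w ≤ 1 := by
  have hs : ∀ v : Option (Fin m) → ℝ, ∑ k, shiftedDistD κ s (some k) v ^ 2 ≤ 1 := by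
    intro v
    simp_rw [shiftedDistD, div_pow]
    rw [← Finset.sum_div, div_le_one (pow_pos (smoothDist_pos s hκ v) 2), smoothDist_sq s hκ]
    linarith [sq_nonneg κ]
  have : ∀ k, shiftedDistD κ s (some k) v * shiftedDistD κ s (some k) w ≤
      (shiftedDistD κ s (some k) v ^ 2 + shiftedDistD κ s (some k) w ^ 2) / 2 := fun k => by
    nlinarith [sq_nonneg (shiftedDistD κ s (some k) v - shiftedDistD κ s (some k) w)]
  refine (Finset.sum_le_sum fun k _ => this k).trans ?_
  rw [← Finset.sum_div, Finset.sum_add_distrib]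
  linarith [hs v, hs w]

end SmoothedNorm

lemma mul_exp_neg_le_one {x : ℝ} : x * exp (-x) ≤ 1 := by
  rw [exp_neg, ← div_eq_mul_inv, div_le_one (exp_pos x)]
  linarith [add_one_le_exp x]

lemma sq_mul_exp_neg_le_two {x : ℝ} (hx : 0 ≤ x) : x ^ 2 * exp (-x) ≤ 2 := by
  rw [exp_neg, ← div_eq_mul_inv, div_le_iff₀ (exp_pos x)]
  linarith [quadratic_le_exp_of_nonneg hx]

/-- Gordon-type comparison for a smooth surrogate of the indicator that all shifted distances
are large. -/
lemma integral_exp_neg_sum_exp_le {I ι : Type*} [Fintype I] [DecidableEq I] [Fintype ι]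
    [DecidableEq ι] {m : ℕ} (A B : ι × Option (Fin m) → I → ℝ)
    (hAB : ∀ k l, ∑ i, A k i * B l i = 0) (D : ι → ι → ℝ)
    (hnn : ∀ a b, ∑ i, A (a, none) i * A (b, none) i - ∑ i, B (a, none) i * B (b, none) i = D a b)
    (hns : ∀ a b l, ∑ i, A (a, none) i * A (b, some l) i -
      ∑ i, B (a, none) i * B (b, some l) i = 0)
    (hsn : ∀ a b k, ∑ i, A (a, some k) i * A (b, none) i -
      ∑ i, B (a, some k) i * B (b, none) i = 0)
    (hss : ∀ a b k l, ∑ i, A (a, some k) i * A (b, some l) i -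
      ∑ i, B (a, some k) i * B (b, some l) i = if k = l then -D a b else 0)
    (hD0 : ∀ a, D a a = 0) (hD : ∀ a b, 0 ≤ D a b)
    {θ κ : ℝ} (hθ : 0 < θ) (hκ : 0 < κ) (s : Fin m → ℝ) (c : ι → ℝ) :
    ∫ w, exp (-∑ a, exp (-(θ * (shiftedDist κ s (fun o => ∑ i, B (a, o) i * w i) - c a))))
        ∂(gaussPi I) ≤
      ∫ w, exp (-∑ a, exp (-(θ * (shiftedDist κ s (fun o => ∑ i, A (a, o) i * w i) - c a))))
        ∂(gaussPi I) := by
  set y : ι → (ι × Option (Fin m) → ℝ) → ℝ := fun a z =>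
    exp (-(θ * (shiftedDist κ s (fun o => z (a, o)) - c a))) with hy
  set E : (ι × Option (Fin m) → ℝ) → ℝ := fun z => exp (-∑ a, y a z) with hE
  set d : ι × Option (Fin m) → (ι × Option (Fin m) → ℝ) → ℝ := fun k z =>
    shiftedDistD κ s k.2 (fun o => z (k.1, o)) with hd
  set F1 : ι × Option (Fin m) → (ι × Option (Fin m) → ℝ) → ℝ := fun k z =>
    θ * y k.1 z * d k z * E z with hF1
  set F2 : ι × Option (Fin m) → ι × Option (Fin m) → (ι × Option (Fin m) → ℝ) → ℝ :=
    fun k l z => F1 k z * (θ * y l.1 z * d l z) +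
      if k.1 = l.1 then (θ * y k.1 z * shiftedDistDD κ s k.2 l.2 (fun o => z (k.1, o)) -
        θ ^ 2 * y k.1 z * d k z * d l z) * E z else 0 with hF2
  have hyc : ∀ a, Continuous (y a) := fun a => by
    have := (continuous_shiftedDist (κ := κ) s).comp
      (by fun_prop : Continuous fun (z : ι × Option (Fin m) → ℝ) o => z (a, o))
    simp only [Function.comp_def] at this
    simp only [hy]
    fun_prop
  have hEc : Continuous E := by simp only [hE]; fun_prop
  have hdc : ∀ k, Continuous (d k) := fun k =>
    (continuous_shiftedDistD s hκ k.2).comp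
      (by fun_prop : Continuous fun (z : ι × Option (Fin m) → ℝ) o => z (k.1, o))
  have hF1c : ∀ k, Continuous (F1 k) := fun k => by simp only [hF1]; fun_prop
  have hF2c : ∀ k l, Continuous (F2 k l) := fun k l => by
    have := (continuous_shiftedDistDD s hκ k.2 l.2).comp
      (by fun_prop : Continuous fun (z : ι × Option (Fin m) → ℝ) o => z (k.1, o))
    simp only [Function.comp_def] at this
    simp only [hF2]
    split_ifs <;> fun_prop
  have hyd : ∀ (a : ι) (z : ℝ → ι × Option (Fin m) → ℝ) (z' : ι × Option (Fin m) → ℝ) (t : ℝ),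
      (∀ k, HasDerivAt (fun r => z r k) (z' k) t) →
      HasDerivAt (fun r => y a (z r))
        (-∑ o, θ * y a (z t) * d (a, o) (z t) * z' (a, o)) t := by
    intro a z z' t hz
    have h := hasDerivAt_shiftedDist s hκ (v := fun r o => z r (a, o))
      (v' := fun o => z' (a, o)) (t := t) fun o => hz (a, o)
    refine ((h.sub_const (c a)).const_mul θ).neg.exp.congr_deriv ?_
    rw [mul_neg, Finset.mul_sum, Finset.mul_sum]
    congr 1
    exact Finset.sum_congr rfl fun o _ => by simp only [hy, hd, Pi.neg_apply]; ring
  have hEd : ∀ (z : ℝ → ι × Option (Fin m) → ℝ) (z' : ι × Option (Fin m) → ℝ) (t : ℝ),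
      (∀ k, HasDerivAt (fun r => z r k) (z' k) t) →
      HasDerivAt (fun r => E (z r)) (∑ k, F1 k (z t) * z' k) t := by
    intro z z' t hz
    have h := HasDerivAt.fun_sum (u := Finset.univ) fun a _ => hyd a z z' t hz
    refine h.fun_neg.exp.congr_deriv ?_
    rw [Finset.sum_neg_distrib, neg_neg, Fintype.sum_prod_type, Finset.mul_sum]
    refine Finset.sum_congr rfl fun a _ => ?_
    rw [Finset.mul_sum]
    exact Finset.sum_congr rfl fun o _ => by simp only [hF1, hE]; ring
  have hF1d : ∀ (k : ι × Option (Fin m)) (z : ℝ → ι × Option (Fin m) → ℝ)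
      (z' : ι × Option (Fin m) → ℝ) (t : ℝ), (∀ l, HasDerivAt (fun r => z r l) (z' l) t) →
      HasDerivAt (fun r => F1 k (z r)) (∑ l, F2 k l (z t) * z' l) t := by
    intro k z z' t hz
    have h := hasDerivAt_shiftedDistD s hκ k.2 (v := fun r o => z r (k.1, o))
      (v' := fun o => z' (k.1, o)) (t := t) fun o => hz (k.1, o)
    refine ((((hyd k.1 z z' t hz).const_mul θ).mul h).mul (hEd z z' t hz)).congr_deriv ?_
    have e : ∀ l, F2 k l (z t) * z' l = θ * y k.1 (z t) * d k (z t) * (F1 l (z t) * z' l) +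
        if k.1 = l.1 then (θ * y k.1 (z t) *
          shiftedDistDD κ s k.2 l.2 (fun o => z t (k.1, o)) * z' l -
          θ * d k (z t) * (θ * y k.1 (z t) * d l (z t) * z' l)) * E (z t) else 0 := by
      intro l
      simp only [hF2, hF1]
      split_ifs <;> ring
    simp_rw [e, Finset.sum_add_distrib, ← Finset.mul_sum]
    rw [add_comm, Fintype.sum_prod_type (f := fun l : ι × Option (Fin m) =>
      if k.1 = l.1 then (θ * y k.1 (z t) *
          shiftedDistDD κ s k.2 l.2 (fun o => z t (k.1, o)) * z' l -
          θ * d k (z t) * (θ * y k.1 (z t) * d l (z t) * z' l)) * E (z t) else 0)]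
    simp only [Finset.sum_ite_irrel, Finset.sum_const_zero]
    rw [Finset.sum_ite_eq, if_pos (Finset.mem_univ _), ← Finset.sum_mul, Finset.sum_sub_distrib,
      ← Finset.mul_sum]
    simp_rw [mul_assoc (θ * y k.1 (z t)), ← Finset.mul_sum]
    simp only [hd, Pi.mul_apply]
    ring
  have hy0 : ∀ a z, 0 < y a z := fun a z => exp_pos _
  have hE0 : ∀ z, 0 < E z := fun z => exp_pos _
  have hS0 : ∀ z, 0 ≤ ∑ a, y a z := fun z => Finset.sum_nonneg fun a _ => (hy0 a z).le
  have hyS : ∀ a z, y a z ≤ ∑ a, y a z := fun a z =>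
    Finset.single_le_sum (f := fun a => y a z) (fun b _ => (hy0 b z).le) (Finset.mem_univ a)
  have hE1 : ∀ z, E z ≤ 1 := fun z => exp_le_one_iff.2 (neg_nonpos.2 (hS0 z))
  have hyE : ∀ a z, y a z * E z ≤ 1 := fun a z =>
    (mul_le_mul_of_nonneg_right (hyS a z) (hE0 z).le).trans mul_exp_neg_le_one
  have hyyE : ∀ a b z, y a z * y b z * E z ≤ 2 := fun a b z => by
    refine le_trans ?_ (sq_mul_exp_neg_le_two (hS0 z))
    rw [sq]
    exact mul_le_mul_of_nonneg_right
      (mul_le_mul (hyS a z) (hyS b z) (hy0 b z).le (hS0 z)) (hE0 z).le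
  have hd1 : ∀ k z, |d k z| ≤ 1 := fun k z => abs_shiftedDistD_le s hκ _ _
  have hF1b : ∀ k z, |F1 k z| ≤ θ := by
    intro k z
    have e : F1 k z = θ * (y k.1 z * E z) * d k z := by simp only [hF1]; ring
    rw [e, abs_mul, abs_of_nonneg (by have := hy0 k.1 z; have := hE0 z; positivity)]
    calc θ * (y k.1 z * E z) * |d k z| ≤ θ * 1 * 1 := by
          gcongr
          · exact hyE _ _
          · exact hd1 _ _
      _ = θ := by ring
  have hF2b : ∀ k l z, |F2 k l z| ≤ 3 * θ ^ 2 + 2 * θ / κ := by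
    intro k l z
    have h1 : |F1 k z * (θ * y l.1 z * d l z)| ≤ 2 * θ ^ 2 := by
      have e : F1 k z * (θ * y l.1 z * d l z) =
        θ ^ 2 * (y k.1 z * y l.1 z * E z) * (d k z * d l z) := by simp only [hF1]; ring
      rw [e, abs_mul, abs_mul (d k z),
        abs_of_nonneg (by have := hy0 k.1 z; have := hy0 l.1 z; have := hE0 z; positivity)]
      calc _ ≤ θ ^ 2 * 2 * (1 * 1) := by
            gcongr
            · exact hyyE _ _ _
            · exact hd1 _ _
            · exact hd1 _ _
        _ = 2 * θ ^ 2 := by ring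
    have h2 : |(θ * y k.1 z * shiftedDistDD κ s k.2 l.2 (fun o => z (k.1, o)) -
        θ ^ 2 * y k.1 z * d k z * d l z) * E z| ≤ θ ^ 2 + 2 * θ / κ := by
      have e : (θ * y k.1 z * shiftedDistDD κ s k.2 l.2 (fun o => z (k.1, o)) -
        θ ^ 2 * y k.1 z * d k z * d l z) * E z = θ * (y k.1 z * E z) *
          (shiftedDistDD κ s k.2 l.2 (fun o => z (k.1, o)) - θ * (d k z * d l z)) := by ring
      have h3 : |shiftedDistDD κ s k.2 l.2 (fun o => z (k.1, o)) - θ * (d k z * d l z)| ≤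
          2 / κ + θ * (1 * 1) := by
        refine (abs_sub _ _).trans (add_le_add (abs_shiftedDistDD_le s hκ _ _ _) ?_)
        rw [abs_mul, abs_mul, abs_of_pos hθ]
        gcongr
        · exact hd1 _ _
        · exact hd1 _ _
      rw [e, abs_mul, abs_of_nonneg (by have := hy0 k.1 z; have := hE0 z; positivity)]
      calc _ ≤ θ * 1 * (2 / κ + θ * (1 * 1)) := by
            gcongr
            exact hyE _ _
        _ = θ ^ 2 + 2 * θ / κ := by ring
    have h4 : 0 ≤ θ ^ 2 + 2 * θ / κ := by positivity
    simp only [hF2]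
    refine (abs_add_le _ _).trans ?_
    split_ifs
    · linarith
    · rw [abs_zero]; linarith
  set C := 1 + θ + (3 * θ ^ 2 + 2 * θ / κ) with hC
  have hC1 : 0 ≤ 3 * θ ^ 2 + 2 * θ / κ := by positivity
  refine integral_gaussPi_le_of_interpolation A B hAB E F1 F2 hEc hF1c hF2c hEd hF1d
    (C := C) (fun z => ?_) (fun k z => (hF1b k z).trans (by linarith))
    (fun k l z => (hF2b k l z).trans (by linarith)) fun z => ?_
  · rw [abs_of_pos (hE0 z)]; linarith [hE1 z]
  · have e : ∑ k, ∑ l, (∑ i, A k i * A l i - ∑ i, B k i * B l i) * F2 k l z =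
        ∑ a, ∑ b, D a b * (F2 (a, none) (b, none) z -
          ∑ k, F2 (a, some k) (b, some k) z) := by
      rw [Fintype.sum_prod_type]
      refine Finset.sum_congr rfl fun a _ => ?_
      simp_rw [Fintype.sum_prod_type (α₁ := ι), Fintype.sum_option, hnn, hns, hsn, hss]
      rw [Finset.sum_comm, ← Finset.sum_add_distrib]
      refine Finset.sum_congr rfl fun b _ => ?_
      simp only [zero_mul, Finset.sum_const_zero, add_zero, zero_add, ite_mul]
      simp_rw [Finset.sum_ite_eq, if_pos (Finset.mem_univ _), mul_sub, Finset.mul_sum, neg_mul,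
        Finset.sum_neg_distrib, sub_eq_add_neg]
    rw [e]
    refine Finset.sum_nonneg fun a _ => Finset.sum_nonneg fun b _ => ?_
    by_cases hab : a = b
    · subst hab; simp [hD0]
    · refine mul_nonneg (hD a b) ?_
      have h1 := sum_shiftedDistD_mul_le s hκ (fun o => z (a, o)) (fun o => z (b, o))
      have e2 : F2 (a, none) (b, none) z - ∑ k, F2 (a, some k) (b, some k) z =
          θ ^ 2 * y a z * y b z * E z * (1 - ∑ k, shiftedDistD κ s (some k) (fun o => z (a, o)) *
            shiftedDistD κ s (some k) (fun o => z (b, o))) := by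
        simp only [hF2, hF1, hd, if_neg hab, add_zero]
        rw [mul_sub, Finset.mul_sum]
        congr 1
        · simp only [shiftedDistD]; ring
        · exact Finset.sum_congr rfl fun k _ => by ring
      rw [e2]
      have := hy0 a z
      have := hy0 b z
      have := hE0 z
      exact mul_nonneg (by positivity) (by linarith)

section Gordon

lemma measurePreserving_sumElim_fst (I J : Type*) [Fintype I] [Fintype J] :
    MeasurePreserving (fun (w : I ⊕ J → ℝ) i => w (Sum.inl i)) (gaussPi (I ⊕ J)) (gaussPi I) :=
  measurePreserving_fst.comp
    (measurePreserving_sumPiEquivProdPi fun _ : I ⊕ J => gaussianReal 0 1)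

lemma measurePreserving_sumElim_snd (I J : Type*) [Fintype I] [Fintype J] :
    MeasurePreserving (fun (w : I ⊕ J → ℝ) i => w (Sum.inr i)) (gaussPi (I ⊕ J)) (gaussPi J) :=
  measurePreserving_snd.comp
    (measurePreserving_sumPiEquivProdPi fun _ : I ⊕ J => gaussianReal 0 1)

lemma measurePreserving_sumElim (I J : Type*) [Fintype I] [Fintype J] :
    MeasurePreserving (fun w : I ⊕ J → ℝ => (fun i => w (Sum.inl i), fun j => w (Sum.inr j)))
      (gaussPi (I ⊕ J)) ((gaussPi I).prod (gaussPi J)) :=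
  measurePreserving_sumPiEquivProdPi fun _ : I ⊕ J => gaussianReal 0 1

lemma measurePreserving_matMeasure (m n : ℕ) :
    MeasurePreserving (fun (w : Fin m × Fin n → ℝ) k j => (√n)⁻¹ * w (k, j))
      (gaussPi (Fin m × Fin n)) (matMeasure m n) := by
  have hcurry : MeasurePreserving (MeasurableEquiv.curry (Fin m) (Fin n) ℝ)
      (gaussPi (Fin m × Fin n)) (Measure.pi fun _ : Fin m => gaussPi (Fin n)) := by
    refine ⟨MeasurableEquiv.measurable _, ?_⟩
    have := Measure.infinitePi_map_curry (ι := Fin m) (κ := Fin n)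
      (fun _ _ => gaussianReal 0 1)
    simpa only [Measure.infinitePi_eq_pi] using this
  have hg : (gaussianReal 0 1).map (fun x => (√n)⁻¹ * x) = gaussianReal 0 ((n : ℝ≥0))⁻¹ := by
    rw [gaussianReal_map_const_mul]
    congr 1
    · simp
    · ext
      simp
  have hrow : MeasurePreserving (fun (u : Fin n → ℝ) j => (√n)⁻¹ * u j) (gaussPi (Fin n))
      (Measure.pi fun _ : Fin n => gaussianReal 0 ((n : ℝ≥0))⁻¹) :=
    measurePreserving_pi _ _ fun _ => ⟨by fun_prop, hg⟩
  exact (measurePreserving_pi (fun _ : Fin m => gaussPi (Fin n)) _ fun _ => hrow).comp hcurry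

lemma half_le_gaussianReal_Iic : (1 / 2 : ℝ) ≤ (gaussianReal 0 1).real (Set.Iic 0) := by
  have h1 : (gaussianReal 0 1).real (Set.Ici 0) = (gaussianReal 0 1).real (Set.Iic 0) := by
    have h := gaussianReal_map_neg (μ := 0) (v := 1)
    rw [neg_zero] at h
    conv_lhs => rw [← h]
    rw [map_measureReal_apply (by fun_prop) measurableSet_Ici]
    congr 1
    ext x
    simp
  have h2 : (gaussianReal 0 1).real (Set.Iic 0 ∪ Set.Ici 0) = 1 := by
    rw [Set.Iic_union_Ici]; simp
  have h3 := measureReal_union_le (μ := gaussianReal 0 1) (Set.Iic (0 : ℝ)) (Set.Ici 0)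
  linarith

variable {ι : Type*} {m n : ℕ}

/-- The normalized Euclidean norm. -/
noncomputable def rms (x : Fin n → ℝ) : ℝ := √((∑ j, x j ^ 2) / n)

lemma rms_nonneg (x : Fin n → ℝ) : 0 ≤ rms x := sqrt_nonneg _

lemma rms_sq (x : Fin n → ℝ) : rms x ^ 2 = (∑ j, x j ^ 2) / n :=
  sq_sqrt (div_nonneg (Finset.sum_nonneg fun _ _ => sq_nonneg _) n.cast_nonneg)

lemma sum_mul_div_le_rms_mul_rms (x y : Fin n → ℝ) :
    (∑ j, x j * y j) / n ≤ rms x * rms y := by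
  rw [rms, rms, ← sqrt_mul (div_nonneg (Finset.sum_nonneg fun _ _ => sq_nonneg _) n.cast_nonneg)]
  refine le_sqrt_of_sq_le ?_
  rw [div_mul_div_comm, div_pow, ← sq]
  exact div_le_div_of_nonneg_right (Finset.sum_mul_sq_le_sq_mul_sq _ _ _) (sq_nonneg _)

/-- Coefficients of the bilinear Gaussian process. -/
noncomputable def bilinCoeff (x : ι → Fin n → ℝ) (p : ι × Option (Fin m)) :
    ((Fin m × Fin n) ⊕ Unit) ⊕ (Fin m ⊕ Fin n) → ℝ :=
  Sum.elim (Sum.elim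
    (fun q => p.2.elim 0 fun k => if k = q.1 then (√n)⁻¹ * x p.1 q.2 else 0)
    (fun _ => p.2.elim (rms (x p.1)) fun _ => 0)) (fun _ => 0)

/-- Coefficients of the decoupled Gaussian process. -/
noncomputable def decoupledCoeff (s : Fin m → ℝ) (x : ι → Fin n → ℝ) (p : ι × Option (Fin m)) :
    ((Fin m × Fin n) ⊕ Unit) ⊕ (Fin m ⊕ Fin n) → ℝ :=
  Sum.elim (fun _ => 0) (Sum.elim
    (fun k' => p.2.elim 0 fun k => if k = k' then rms (x p.1) * s k else 0)
    (fun j => p.2.elim (-((√n)⁻¹ * x p.1 j)) fun _ => 0))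

lemma sum_bilinCoeff_none (x : ι → Fin n → ℝ) (a : ι)
    (w : ((Fin m × Fin n) ⊕ Unit) ⊕ (Fin m ⊕ Fin n) → ℝ) :
    ∑ i, bilinCoeff x (a, none) i * w i = rms (x a) * w (Sum.inl (Sum.inr ())) := by
  simp [bilinCoeff, Fintype.sum_sum_type]

lemma sum_bilinCoeff_some (x : ι → Fin n → ℝ) (a : ι) (k : Fin m)
    (w : ((Fin m × Fin n) ⊕ Unit) ⊕ (Fin m ⊕ Fin n) → ℝ) :
    ∑ i, bilinCoeff x (a, some k) i * w i =
      mulV (fun k j => (√n)⁻¹ * w (Sum.inl (Sum.inl (k, j)))) (x a) k := by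
  simp only [bilinCoeff, Fintype.sum_sum_type, Fintype.sum_prod_type, mulV]
  simp only [Sum.elim_inl, Sum.elim_inr, Option.elim_some, ite_mul, zero_mul,
    Finset.sum_const_zero, add_zero, Finset.sum_ite_irrel, Finset.sum_ite_eq,
    Finset.mem_univ, if_true]
  exact Finset.sum_congr rfl fun j _ => by ring

lemma sum_decoupledCoeff_none (s : Fin m → ℝ) (x : ι → Fin n → ℝ) (a : ι)
    (w : ((Fin m × Fin n) ⊕ Unit) ⊕ (Fin m ⊕ Fin n) → ℝ) :
    ∑ i, decoupledCoeff s x (a, none) i * w i =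
      -((√n)⁻¹ * ∑ j, w (Sum.inr (Sum.inr j)) * x a j) := by
  simp only [decoupledCoeff, Fintype.sum_sum_type]
  simp only [Sum.elim_inl, Sum.elim_inr, Option.elim_none, zero_mul,
    Finset.sum_const_zero, zero_add, Finset.mul_sum, ← Finset.sum_neg_distrib]
  exact Finset.sum_congr rfl fun j _ => by ring

lemma sum_decoupledCoeff_some (s : Fin m → ℝ) (x : ι → Fin n → ℝ) (a : ι) (k : Fin m)
    (w : ((Fin m × Fin n) ⊕ Unit) ⊕ (Fin m ⊕ Fin n) → ℝ) :
    ∑ i, decoupledCoeff s x (a, some k) i * w i =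
      rms (x a) * s k * w (Sum.inr (Sum.inl k)) := by
  simp [decoupledCoeff, Fintype.sum_sum_type]

lemma integral_decoupled_le_bilin [Fintype ι] [DecidableEq ι] {s : Fin m → ℝ}
    (hs : ∀ k, s k = 1 ∨ s k = -1) (x : ι → Fin n → ℝ) {θ κ : ℝ} (hθ : 0 < θ) (hκ : 0 < κ)
    (c : ι → ℝ) :
    ∫ w, exp (-∑ a, exp (-(θ * (shiftedDist κ s
        (fun o => ∑ i, decoupledCoeff s x (a, o) i * w i) - c a)))) ∂(gaussPi _) ≤
      ∫ w, exp (-∑ a, exp (-(θ * (shiftedDist κ s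
        (fun o => ∑ i, bilinCoeff x (a, o) i * w i) - c a)))) ∂(gaussPi _) := by
  have hn : (√(n : ℝ))⁻¹ * (√(n : ℝ))⁻¹ = (n : ℝ)⁻¹ := by
    rw [← mul_inv, mul_self_sqrt n.cast_nonneg]
  have hs2 : ∀ k, s k * s k = 1 := fun k => by rcases hs k with h | h <;> simp [h]
  refine integral_exp_neg_sum_exp_le (bilinCoeff x) (decoupledCoeff s x) ?_
    (fun a b => rms (x a) * rms (x b) - (∑ j, x a j * x b j) / n) ?_ ?_ ?_ ?_ ?_ ?_ hθ hκ s c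
  · intro k l
    simp [bilinCoeff, decoupledCoeff, Fintype.sum_sum_type]
  · intro a b
    rw [sum_bilinCoeff_none, sum_decoupledCoeff_none]
    simp only [bilinCoeff, decoupledCoeff, Sum.elim_inl, Sum.elim_inr, Option.elim_none]
    rw [Finset.mul_sum, Finset.sum_div, ← Finset.sum_neg_distrib]
    congr 1
    refine Finset.sum_congr rfl fun j _ => ?_
    rw [div_eq_mul_inv, ← hn]
    ring
  · intro a b l
    rw [sum_bilinCoeff_none, sum_decoupledCoeff_none]
    simp [bilinCoeff, decoupledCoeff]
  · intro a b k
    rw [sum_bilinCoeff_some, sum_decoupledCoeff_some]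
    simp [bilinCoeff, decoupledCoeff, mulV]
  · intro a b k l
    rw [sum_bilinCoeff_some, sum_decoupledCoeff_some]
    simp only [bilinCoeff, decoupledCoeff, Sum.elim_inl, Sum.elim_inr, Option.elim_some, mulV]
    by_cases h : k = l
    · subst h
      simp only [if_true]
      rw [show rms (x a) * s k * (rms (x b) * s k) = rms (x a) * rms (x b) * (s k * s k) by ring,
        hs2, Finset.sum_div, neg_sub, mul_one]
      congr 1
      refine Finset.sum_congr rfl fun j _ => ?_
      rw [div_eq_mul_inv, ← hn]
      ring
    · simp [h, Ne.symm h]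
  · intro a
    have := rms_sq (x a)
    simp only [sq] at this
    rw [this, sub_self]
  · exact fun a b => sub_nonneg.2 (sum_mul_div_le_rms_mul_rms _ _)

end Gordon

section GordonMeasure

variable {Ω : Type*} [MeasurableSpace Ω] {μ : Measure Ω} [IsProbabilityMeasure μ]

lemma integral_exp_neg_sum_exp_le_of_event {ι : Type*} [Fintype ι] {θ : ℝ} (hθ : 0 ≤ θ)
    {f : ι → Ω → ℝ} (hf : ∀ a, Measurable (f a)) {E : Set Ω} (hE : MeasurableSet E)
    (h : ∀ w ∈ E, ∃ a, f a w ≤ 0) :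
    ∫ w, exp (-∑ a, exp (-(θ * f a w))) ∂μ ≤ 1 - μ.real E / 2 := by
  have hS : ∀ w, 0 ≤ ∑ a, exp (-(θ * f a w)) := fun w =>
    Finset.sum_nonneg fun a _ => (exp_pos _).le
  have hind : Integrable (E.indicator (fun _ => (1 / 2 : ℝ))) μ :=
    (integrable_const _).indicator hE
  have hint : Integrable (fun w => exp (-∑ a, exp (-(θ * f a w)))) μ := by
    refine Integrable.of_bound (by fun_prop) 1 (ae_of_all _ fun w => ?_)
    rw [norm_eq_abs, abs_of_pos (exp_pos _), exp_le_one_iff]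
    exact neg_nonpos.2 (hS w)
  calc ∫ w, exp (-∑ a, exp (-(θ * f a w))) ∂μ
      ≤ ∫ w, (1 - E.indicator (fun _ => (1 / 2 : ℝ)) w) ∂μ := by
        refine integral_mono hint ((integrable_const 1).sub hind) fun w => ?_
        by_cases hw : w ∈ E
        · obtain ⟨a, ha⟩ := h w hw
          have h1 : 1 ≤ ∑ a, exp (-(θ * f a w)) :=
            (one_le_exp (by nlinarith)).trans
              (Finset.single_le_sum (f := fun a => exp (-(θ * f a w)))
                (fun b _ => (exp_pos _).le) (Finset.mem_univ a))
          have h2 : exp (-∑ a, exp (-(θ * f a w))) ≤ exp (-1) := exp_le_exp.2 (by linarith)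
          have h3 : exp (-1) ≤ 1 / 2 := by
            rw [exp_neg, inv_eq_one_div]
            exact one_div_le_one_div_of_le two_pos (by linarith [add_one_le_exp (1 : ℝ)])
          simp only [Set.indicator_of_mem hw]
          linarith
        · simpa only [Set.indicator_of_notMem hw, sub_zero, exp_le_one_iff, neg_nonpos] using hS w
    _ = 1 - μ.real E / 2 := by
        rw [integral_sub (integrable_const 1) hind, integral_indicator hE]
        simp
        ring

lemma le_integral_exp_neg_sum_exp_of_event {ι : Type*} [Fintype ι] {θ r : ℝ} (hθ : 0 ≤ θ)
    {f : ι → Ω → ℝ} (hf : ∀ a, Measurable (f a)) {E : Set Ω} (hE : MeasurableSet E)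
    (h : ∀ w ∉ E, ∀ a, r ≤ f a w) :
    exp (-(Fintype.card ι * exp (-(θ * r)))) - μ.real E ≤
      ∫ w, exp (-∑ a, exp (-(θ * f a w))) ∂μ := by
  have hS : ∀ w, 0 ≤ ∑ a, exp (-(θ * f a w)) := fun w =>
    Finset.sum_nonneg fun a _ => (exp_pos _).le
  have hind : Integrable (E.indicator (fun _ => (1 : ℝ))) μ :=
    (integrable_const _).indicator hE
  have hint : Integrable (fun w => exp (-∑ a, exp (-(θ * f a w)))) μ := by
    refine Integrable.of_bound (by fun_prop) 1 (ae_of_all _ fun w => ?_)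
    rw [norm_eq_abs, abs_of_pos (exp_pos _), exp_le_one_iff]
    exact neg_nonpos.2 (hS w)
  calc exp (-(Fintype.card ι * exp (-(θ * r)))) - μ.real E
      = ∫ w, (exp (-(Fintype.card ι * exp (-(θ * r)))) - E.indicator (fun _ => (1 : ℝ)) w) ∂μ := by
        rw [integral_sub (integrable_const _) hind, integral_indicator hE]
        simp
    _ ≤ _ := by
        refine integral_mono ((integrable_const _).sub hind) hint fun w => ?_
        by_cases hw : w ∈ E
        · simp only [Set.indicator_of_mem hw]
          have h1 : exp (-(Fintype.card ι * exp (-(θ * r)))) ≤ 1 :=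
            exp_le_one_iff.2 (neg_nonpos.2 (by positivity))
          linarith [exp_pos (-∑ a, exp (-(θ * f a w)))]
        · simp only [Set.indicator_of_notMem hw, sub_zero]
          refine exp_le_exp.2 (neg_le_neg ?_)
          rw [← nsmul_eq_mul]
          refine Finset.sum_le_card_nsmul _ _ _ fun a _ => exp_le_exp.2 (neg_le_neg ?_)
          exact mul_le_mul_of_nonneg_left (h w hw a) hθ

/-- Gordon's min-max comparison for finitely many vectors. -/
lemma matMeasure_exists_dist_le {ι : Type*} [Fintype ι] [DecidableEq ι] {m n : ℕ} (hn : 0 < n)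
    {s : Fin m → ℝ} (hs : ∀ k, s k = 1 ∨ s k = -1) (x : ι → Fin n → ℝ) (t : ι → ℝ) {η : ℝ}
    (hη : 0 < η) :
    (matMeasure m n).real {H | ∃ a, √(∑ k, (mulV H (x a) k - s k) ^ 2) ≤ √n * t a} ≤
      4 * ((gaussPi (Fin m)).prod (gaussPi (Fin n))).real
        {p | ∃ a, √(∑ k, (rms (x a) * p.1 k - 1) ^ 2) / √n - (∑ j, p.2 j * x a j) / n <
          t a + 2 * η} := by
  have hn0 : (0 : ℝ) < √n := sqrt_pos.2 (Nat.cast_pos.2 hn)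
  set PO := {H : Fin m → Fin n → ℝ | ∃ a, √(∑ k, (mulV H (x a) k - s k) ^ 2) ≤ √n * t a} with hPO
  set AO := {p : (Fin m → ℝ) × (Fin n → ℝ) | ∃ a, √(∑ k, (rms (x a) * p.1 k - 1) ^ 2) / √n -
    (∑ j, p.2 j * x a j) / n < t a + 2 * η} with hAO
  have hPOm : MeasurableSet PO := by
    rw [hPO, Set.ofPred_exists]
    refine MeasurableSet.iUnion fun a => measurableSet_le ?_ measurable_const
    unfold mulV
    fun_prop
  have hAOm : MeasurableSet AO := by
    rw [hAO, Set.ofPred_exists]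
    refine MeasurableSet.iUnion fun a => measurableSet_lt ?_ measurable_const
    fun_prop
  set κ := √n * η with hκ
  have hκ0 : 0 < κ := mul_pos hn0 hη
  set c : ι → ℝ := fun a => √n * (t a + η) with hc
  set toPO : (((Fin m × Fin n) ⊕ Unit) ⊕ (Fin m ⊕ Fin n) → ℝ) → (Fin m → Fin n → ℝ) × (Unit → ℝ) :=
    fun w => (fun k j => (√n)⁻¹ * w (Sum.inl (Sum.inl (k, j))), fun u => w (Sum.inl (Sum.inr u)))
  have htoPO : MeasurePreserving toPO (gaussPi _) ((matMeasure m n).prod (gaussPi Unit)) := by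
    have : SigmaFinite (matMeasure m n) := by unfold matMeasure; infer_instance
    exact ((measurePreserving_matMeasure m n).prod (MeasurePreserving.id (gaussPi Unit))).comp
      ((measurePreserving_sumElim _ _).comp (measurePreserving_sumElim_fst _ _))
  set toAO : (((Fin m × Fin n) ⊕ Unit) ⊕ (Fin m ⊕ Fin n) → ℝ) → (Fin m → ℝ) × (Fin n → ℝ) :=
    fun w => (fun k => w (Sum.inr (Sum.inl k)), fun j => w (Sum.inr (Sum.inr j)))
  have htoAO : MeasurePreserving toAO (gaussPi _) ((gaussPi (Fin m)).prod (gaussPi (Fin n))) :=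
    (measurePreserving_sumElim _ _).comp (measurePreserving_sumElim_snd _ _)
  have hnegm : MeasurableSet {u : Unit → ℝ | u () ≤ 0} :=
    measurableSet_le (by fun_prop) measurable_const
  have half_le := half_le_gaussianReal_Iic
  have hneg : (1 / 2 : ℝ) ≤ (gaussPi Unit).real {u | u () ≤ 0} := by
    rw [← (measurePreserving_eval (fun _ : Unit => gaussianReal 0 1) ()).measureReal_preimage
      (s := Set.Iic 0) measurableSet_Iic.nullMeasurableSet] at half_le
    exact half_le
  set E₁ := toPO ⁻¹' (PO ×ˢ {u : Unit → ℝ | u () ≤ 0}) with hE₁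
  set E₂ := toAO ⁻¹' AO with hE₂
  have hE₁m : MeasurableSet E₁ := htoPO.measurable (hPOm.prod hnegm)
  have hE₂m : MeasurableSet E₂ := htoAO.measurable hAOm
  have hE₁P : (matMeasure m n).real PO * (1 / 2) ≤ (gaussPi _).real E₁ := by
    rw [hE₁, htoPO.measureReal_preimage (hPOm.prod hnegm).nullMeasurableSet,
      measureReal_prod_prod]
    exact mul_le_mul_of_nonneg_left hneg measureReal_nonneg
  have hE₂P : (gaussPi _).real E₂ = ((gaussPi (Fin m)).prod (gaussPi (Fin n))).real AO :=
    htoAO.measureReal_preimage hAOm.nullMeasurableSet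
  have hB : ∀ w ∈ E₁, ∃ a,
      shiftedDist κ s (fun o => ∑ i, bilinCoeff x (a, o) i * w i) - c a ≤ 0 := by
    rintro w ⟨⟨a, ha⟩, hw⟩
    refine ⟨a, ?_⟩
    simp only [shiftedDist, smoothDist, sum_bilinCoeff_none, sum_bilinCoeff_some]
    have hw' : rms (x a) * w (Sum.inl (Sum.inr ())) ≤ 0 :=
      mul_nonpos_of_nonneg_of_nonpos (rms_nonneg _) hw
    have h1 : ∀ S : ℝ, 0 ≤ S → √(κ ^ 2 + S) ≤ κ + √S := fun S hS =>
      sqrt_le_iff.2 ⟨by positivity, by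
        nlinarith [sq_sqrt hS, mul_nonneg hκ0.le (sqrt_nonneg S)]⟩
    have h2 := h1 _ (Finset.sum_nonneg fun (k : Fin m) (_ : k ∈ Finset.univ) =>
      sq_nonneg (mulV (fun k j => (√n)⁻¹ * w (Sum.inl (Sum.inl (k, j)))) (x a) k - s k))
    simp only [toPO] at ha
    simp only [hc]
    linarith
  have hA : ∀ w ∉ E₂, ∀ a,
      κ ≤ shiftedDist κ s (fun o => ∑ i, decoupledCoeff s x (a, o) i * w i) - c a := by
    intro w hw a
    have hw' : t a + 2 * η ≤ √(∑ k, (rms (x a) * w (Sum.inr (Sum.inl k)) - 1) ^ 2) / √n -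
        (∑ j, w (Sum.inr (Sum.inr j)) * x a j) / n := by
      by_contra! hlt
      exact hw ⟨a, hlt⟩
    simp only [shiftedDist, smoothDist, sum_decoupledCoeff_none, sum_decoupledCoeff_some]
    have h1 : ∑ k, (rms (x a) * w (Sum.inr (Sum.inl k)) - 1) ^ 2 =
        ∑ k, (rms (x a) * s k * w (Sum.inr (Sum.inl k)) - s k) ^ 2 := by
      refine Finset.sum_congr rfl fun k _ => ?_
      rcases hs k with h | h <;> rw [h] <;> ring
    have h2 : √(∑ k, (rms (x a) * w (Sum.inr (Sum.inl k)) - 1) ^ 2) ≤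
        √(κ ^ 2 + ∑ k, (rms (x a) * s k * w (Sum.inr (Sum.inl k)) - s k) ^ 2) := by
      rw [h1]
      exact sqrt_le_sqrt (by nlinarith [sq_nonneg κ])
    have h3 : √n * ((∑ j, w (Sum.inr (Sum.inr j)) * x a j) / n) =
        (√n)⁻¹ * ∑ j, w (Sum.inr (Sum.inr j)) * x a j := by
      rw [← sqrt_div_self]
      ring
    have h4 := mul_le_mul_of_nonneg_left hw' hn0.le
    rw [mul_sub, h3, mul_div_cancel₀ _ hn0.ne'] at h4
    simp only [hc, hκ] at h2 ⊢
    linarith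
  have hmeas : ∀ F : ι × Option (Fin m) → ((Fin m × Fin n) ⊕ Unit) ⊕ (Fin m ⊕ Fin n) → ℝ, ∀ a,
      Measurable fun w : ((Fin m × Fin n) ⊕ Unit) ⊕ (Fin m ⊕ Fin n) → ℝ =>
        shiftedDist κ s (fun o => ∑ i, F (a, o) i * w i) - c a := fun F a =>
    (((continuous_shiftedDist s).measurable).comp (by fun_prop)).sub_const _
  have key : ∀ θ : ℝ, 0 < θ → exp (-(Fintype.card ι * exp (-(θ * κ)))) -
      (gaussPi _).real E₂ ≤ 1 - (gaussPi _).real E₁ / 2 := fun θ hθ =>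
    (le_integral_exp_neg_sum_exp_of_event hθ.le (hmeas _) hE₂m hA).trans
      ((integral_decoupled_le_bilin hs x hθ hκ0 c).trans
        (integral_exp_neg_sum_exp_le_of_event hθ.le (hmeas _) hE₁m hB))
  have hlim : Filter.Tendsto (fun θ : ℝ => exp (-(Fintype.card ι * exp (-(θ * κ)))) -
      (gaussPi _).real E₂) Filter.atTop (nhds (exp (-(Fintype.card ι * 0)) -
        (gaussPi _).real E₂)) := by
    refine Filter.Tendsto.sub_const ?_ _
    refine (continuous_exp.tendsto _).comp (Filter.Tendsto.neg (Filter.Tendsto.const_mul _ ?_))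
    exact tendsto_exp_neg_atTop_nhds_zero.comp (Filter.tendsto_id.atTop_mul_const hκ0)
  have := le_of_tendsto hlim ((Filter.eventually_gt_atTop 0).mono key)
  simp only [mul_zero, neg_zero, exp_zero] at this
  linarith

end GordonMeasure

section Chernoff

lemma zero_mem_interior_integrableExpSet_gaussianReal {Y : ℝ → ℝ} (hY : Measurable Y) {C : ℝ}
    (hC : ∀ h, |Y h| ≤ C * (1 + h ^ 2)) :
    0 ∈ interior (integrableExpSet Y (gaussianReal 0 1)) := by
  obtain ⟨c, hc, hint⟩ := IsGaussian.exists_integrable_exp_sq (gaussianReal 0 1)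
  have hC0 : 0 ≤ C := by simpa using (abs_nonneg _).trans (hC 0)
  have hr : 0 < c / (C + 1) := by positivity
  rw [mem_interior_iff_mem_nhds]
  refine Filter.mem_of_superset (Metric.ball_mem_nhds 0 hr) fun t ht => ?_
  rw [mem_ball_zero_iff, norm_eq_abs, lt_div_iff₀ (by positivity)] at ht
  refine (hint.const_mul (exp c)).mono' (by fun_prop) (ae_of_all _ fun h => ?_)
  rw [norm_eq_abs, abs_of_pos (exp_pos _), ← exp_add, norm_eq_abs, sq_abs]
  refine exp_le_exp.2 ((le_abs_self _).trans ?_)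
  rw [abs_mul]
  have h1 := mul_le_mul_of_nonneg_left (hC h) (abs_nonneg t)
  have h2 : |t| * C ≤ c := by nlinarith [abs_nonneg t]
  nlinarith [sq_nonneg h]

lemma integrable_gaussianReal_of_abs_le {Y : ℝ → ℝ} (hY : Measurable Y) {C : ℝ}
    (hC : ∀ h, |Y h| ≤ C * (1 + h ^ 2)) : Integrable Y (gaussianReal 0 1) :=
  integrable_of_mem_interior_integrableExpSet
    (zero_mem_interior_integrableExpSet_gaussianReal hY hC)

/-- Chernoff bound for the lower tail of an i.i.d. sum of a function of standard Gaussians. -/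
lemma exists_gaussPi_sum_le {Y : ℝ → ℝ} (hY : Measurable Y) {C : ℝ}
    (hC : ∀ h, |Y h| ≤ C * (1 + h ^ 2)) {b : ℝ} (hb : b < ∫ h, Y h ∂(gaussianReal 0 1)) :
    ∃ c > 0, ∀ n : ℕ, (gaussPi (Fin n)).real {h | ∑ i, Y (h i) ≤ n * b} ≤ exp (-(c * n)) := by
  have h0 := zero_mem_interior_integrableExpSet_gaussianReal hY hC
  set ψ : ℝ → ℝ := fun t => exp (-t * b) * mgf Y (gaussianReal 0 1) t with hψ
  have hd : HasDerivAt ψ (∫ h, Y h ∂(gaussianReal 0 1) - b) 0 := by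
    have h1 := hasDerivAt_mgf h0
    have h2 : HasDerivAt (fun t : ℝ => exp (-t * b)) (-b) 0 := by
      have := (((hasDerivAt_id' (0 : ℝ)).neg).mul_const b).exp
      simpa using this
    refine (h2.mul h1).congr_deriv ?_
    simp
    ring
  have hψ0 : ψ 0 = 1 := by simp [hψ]
  obtain ⟨t, ht0, htint, htlt⟩ : ∃ t < 0, t ∈ integrableExpSet Y (gaussianReal 0 1) ∧ ψ t < 1 := by
    have h1 : ∀ᶠ t in nhdsWithin 0 (Set.Iio 0), ψ t < ψ 0 := by
      have := hd.tendsto_slope.mono_left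
        (nhdsWithin_mono 0 (fun x hx => ne_of_lt hx : Set.Iio (0 : ℝ) ⊆ {0}ᶜ))
      filter_upwards [this.eventually (lt_mem_nhds (sub_pos.2 hb)), self_mem_nhdsWithin]
        with t ht ht0
      have ht0' : t < 0 := ht0
      rw [slope_def_field, sub_zero, div_pos_iff] at ht
      rcases ht with ht | ht <;> linarith
    have h2 : ∀ᶠ t in nhdsWithin 0 (Set.Iio 0), t ∈ integrableExpSet Y (gaussianReal 0 1) :=
      nhdsWithin_le_nhds (mem_interior_iff_mem_nhds.1 h0)
    obtain ⟨t, ⟨h, h'⟩, h''⟩ := ((h1.and h2).and self_mem_nhdsWithin).exists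
    exact ⟨t, h'', h', hψ0 ▸ h⟩
  have hpos : 0 < ψ t := mul_pos (exp_pos _) (mgf_pos htint)
  refine ⟨-log (ψ t), neg_pos.2 (log_neg hpos htlt), fun n => ?_⟩
  have hprod : ∀ h : Fin n → ℝ, exp (t * ∑ i, Y (h i)) = ∏ i, exp (t * Y (h i)) := fun h => by
    rw [Finset.mul_sum, exp_sum]
  have hint : Integrable (fun h : Fin n → ℝ => exp (t * ∑ i, Y (h i))) (gaussPi (Fin n)) := by
    simp_rw [hprod]
    exact Integrable.fintype_prod (f := fun _ h => exp (t * Y h)) fun _ => htint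
  have hmgf : mgf (fun h : Fin n → ℝ => ∑ i, Y (h i)) (gaussPi (Fin n)) t =
      mgf Y (gaussianReal 0 1) t ^ n := by
    simp only [mgf]
    simp_rw [hprod]
    rw [integral_fintype_prod_eq_prod (f := fun _ h => exp (t * Y h))]
    simp
  refine (measure_le_le_exp_mul_mgf _ ht0.le hint).trans ?_
  rw [hmgf, show -(-log (ψ t) * n) = n * log (ψ t) by ring, ← log_pow, exp_log (pow_pos hpos n),
    hψ, mul_pow, ← exp_nat_mul]
  refine le_of_eq ?_
  congr 2
  ring

end Chernoff

section ExpSmall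

/-- A family of events in pairs of standard Gaussian vectors of dimensions `m = δ n` and `n`
has exponentially small probability. -/
def ExpSmall (δ : ℝ) (E : ∀ m n : ℕ, Set ((Fin m → ℝ) × (Fin n → ℝ))) : Prop :=
  ∃ C c : ℝ, 0 ≤ C ∧ 0 < c ∧ ∀ n m : ℕ, 0 < n → (m : ℝ) = δ * n →
    ((gaussPi (Fin m)).prod (gaussPi (Fin n))).real (E m n) ≤ C * exp (-(c * n))

variable {δ : ℝ} {E E' : ∀ m n : ℕ, Set ((Fin m → ℝ) × (Fin n → ℝ))}

lemma ExpSmall.mono (h : ExpSmall δ E')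
    (hE : ∀ m n : ℕ, 0 < n → (m : ℝ) = δ * n → E m n ⊆ E' m n) : ExpSmall δ E := by
  obtain ⟨C, c, hC, hc, h⟩ := h
  exact ⟨C, c, hC, hc, fun n m hn hm =>
    (measureReal_mono (hE m n hn hm)).trans (h n m hn hm)⟩

lemma ExpSmall.union (h : ExpSmall δ E) (h' : ExpSmall δ E') :
    ExpSmall δ fun m n => E m n ∪ E' m n := by
  obtain ⟨C, c, hC, hc, h⟩ := h
  obtain ⟨C', c', hC', hc', h'⟩ := h'
  refine ⟨C + C', min c c', by positivity, lt_min hc hc', fun n m hn hm => ?_⟩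
  refine (measureReal_union_le _ _).trans ?_
  rw [add_mul]
  refine add_le_add ((h n m hn hm).trans ?_) ((h' n m hn hm).trans ?_)
  · gcongr
    exact min_le_left _ _
  · gcongr
    exact min_le_right _ _

lemma expSmall_empty : ExpSmall δ fun _ _ => ∅ :=
  ⟨0, 1, le_rfl, one_pos, fun n m _ _ => by simp⟩

lemma expSmall_sum_snd_le {Y : ℝ → ℝ} (hY : Measurable Y) {C : ℝ}
    (hC : ∀ h, |Y h| ≤ C * (1 + h ^ 2)) {b : ℝ} (hb : b < ∫ h, Y h ∂(gaussianReal 0 1)) :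
    ExpSmall δ fun _ n => {p | ∑ j, Y (p.2 j) ≤ n * b} := by
  obtain ⟨c, hc, h⟩ := exists_gaussPi_sum_le hY hC hb
  refine ⟨1, c, zero_le_one, hc, fun n m _ _ => ?_⟩
  rw [one_mul]
  refine le_of_eq_of_le ?_ (h n)
  have hm : MeasurableSet {h : Fin n → ℝ | ∑ i, Y (h i) ≤ n * b} :=
    measurableSet_le (by fun_prop) measurable_const
  exact (measurePreserving_snd (μ := gaussPi (Fin m))
    (ν := gaussPi (Fin n))).measureReal_preimage hm.nullMeasurableSet

lemma expSmall_sum_fst_le (hδ : 0 < δ) {Y : ℝ → ℝ} (hY : Measurable Y) {C : ℝ}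
    (hC : ∀ h, |Y h| ≤ C * (1 + h ^ 2)) {b : ℝ} (hb : b < ∫ h, Y h ∂(gaussianReal 0 1)) :
    ExpSmall δ fun m _ => {p | ∑ k, Y (p.1 k) ≤ m * b} := by
  obtain ⟨c, hc, h⟩ := exists_gaussPi_sum_le hY hC hb
  refine ⟨1, c * δ, zero_le_one, mul_pos hc hδ, fun n m _ hmn => ?_⟩
  rw [one_mul, mul_assoc, ← hmn]
  refine le_of_eq_of_le ?_ (h m)
  have hm : MeasurableSet {g : Fin m → ℝ | ∑ i, Y (g i) ≤ m * b} :=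
    measurableSet_le (by fun_prop) measurable_const
  exact (measurePreserving_fst (μ := gaussPi (Fin m))
    (ν := gaussPi (Fin n))).measureReal_preimage hm.nullMeasurableSet

lemma integral_sq_gaussianReal : ∫ h, h ^ 2 ∂(gaussianReal 0 1) = 1 := by
  have h := variance_eq_integral (X := fun x : ℝ => x) (μ := gaussianReal 0 1) (by fun_prop)
  rw [variance_fun_id_gaussianReal, integral_id_gaussianReal] at h
  simpa using h.symm

lemma expSmall_dist_lt (hδ : 0 < δ) {A η : ℝ} (hA : 0 < A) (hη : 0 < η) :
    ExpSmall δ fun _ n => {p | ∃ σ, 0 ≤ σ ∧ σ ≤ A ∧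
      √(∑ k, (σ * p.1 k - 1) ^ 2) / √n < √(δ * (σ ^ 2 + 1)) - η} := by
  set ε := η ^ 2 / (δ * (A ^ 2 + 2 * A)) with hε
  have hε0 : 0 < ε := by positivity
  have h1 : ExpSmall δ fun m _ => {p | ∑ k, p.1 k ^ 2 ≤ m * (1 - ε)} := by
    refine expSmall_sum_fst_le hδ (Y := fun h => h ^ 2) (by fun_prop) (C := 1) (fun h => ?_) ?_
    · rw [abs_of_nonneg (sq_nonneg h)]; linarith
    · rw [integral_sq_gaussianReal]; linarith
  have h2 : ExpSmall δ fun m _ => {p | ∑ k, -p.1 k ≤ m * (-ε)} := by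
    refine expSmall_sum_fst_le hδ (Y := fun h => -h) (by fun_prop) (C := 1) (fun h => ?_) ?_
    · rw [abs_neg]
      nlinarith [sq_nonneg (|h| - 1), sq_abs h, sq_nonneg h]
    · rw [integral_neg, integral_id_gaussianReal]; linarith
  refine (h1.union h2).mono fun m n hn hm p hp => ?_
  obtain ⟨σ, hσ0, hσA, hlt⟩ := hp
  by_contra! hcon
  simp only [Set.mem_union, Set.mem_ofPred_eq, not_or, not_le, Finset.sum_neg_distrib] at hcon
  obtain ⟨hc1, hc2⟩ := hcon
  have hn' : (0 : ℝ) < n := Nat.cast_pos.2 hn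
  have hexp : ∑ k, (σ * p.1 k - 1) ^ 2 = σ ^ 2 * ∑ k, p.1 k ^ 2 - 2 * σ * ∑ k, p.1 k + m := by
    have : ∀ k, (σ * p.1 k - 1) ^ 2 = σ ^ 2 * p.1 k ^ 2 - 2 * σ * p.1 k + 1 := fun k => by ring
    simp_rw [this, Finset.sum_add_distrib, Finset.sum_sub_distrib, ← Finset.mul_sum]
    simp
  have hm0 : (0 : ℝ) ≤ m := m.cast_nonneg
  have hlow : m * (σ ^ 2 + 1) - m * (ε * (A ^ 2 + 2 * A)) ≤ ∑ k, (σ * p.1 k - 1) ^ 2 := by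
    have e1 := mul_le_mul_of_nonneg_left hc1.le (sq_nonneg σ)
    have e2 := mul_le_mul_of_nonneg_left hc2.le hσ0
    have e3 : σ ^ 2 + 2 * σ ≤ A ^ 2 + 2 * A := by nlinarith
    have e4 := mul_le_mul_of_nonneg_left e3 (mul_nonneg hm0 hε0.le)
    rw [hexp]
    nlinarith
  have hεη : δ * (ε * (A ^ 2 + 2 * A)) = η ^ 2 := by
    rw [hε]; field_simp
  set S : ℝ := (∑ k, (σ * p.1 k - 1) ^ 2) / (n : ℝ) with hS
  have hS0 : 0 ≤ S := div_nonneg (Finset.sum_nonneg fun _ _ => sq_nonneg _) hn'.le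
  have hSlow : δ * (σ ^ 2 + 1) - η ^ 2 ≤ S := by
    rw [hS, le_div_iff₀ hn', ← hεη]
    rw [hm] at hlow
    linarith
  rw [← sqrt_div (Finset.sum_nonneg fun _ _ => sq_nonneg _)] at hlt
  have : √(δ * (σ ^ 2 + 1)) ≤ √S + η :=
    sqrt_le_iff.2 ⟨by positivity, by nlinarith [sq_sqrt hS0, mul_nonneg (sqrt_nonneg S) hη.le]⟩
  linarith

end ExpSmall

section ScalarProblem

/-- The objective of the scalar box-constrained problem in `phiFn`. -/
noncomputable def scalarObj (τ β lam h x : ℝ) : ℝ :=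
  β / (2 * τ) * x ^ 2 + lam * x ^ 2 - β * h * x

/-- The value of the scalar box-constrained problem in `phiFn`. -/
noncomputable def scalarVal (τ β lam A h : ℝ) : ℝ :=
  sInf ((fun x : ℝ => scalarObj τ β lam h x) '' Set.Icc (-A) A)

variable {τ β lam A : ℝ}

lemma neg_le_scalarObj (hτ : 0 < τ) (hβ : 0 < β) (hlam : 0 ≤ lam) {h x : ℝ} (hx : |x| ≤ A) :
    -(β * A * |h|) ≤ scalarObj τ β lam h x := by
  have h1 : β * h * x ≤ β * A * |h| := by
    have : h * x ≤ |h| * A := by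
      refine (le_abs_self _).trans ?_
      rw [abs_mul]
      gcongr
    nlinarith
  have h2 : 0 ≤ β / (2 * τ) * x ^ 2 := by positivity
  have h3 : 0 ≤ lam * x ^ 2 := by positivity
  unfold scalarObj
  linarith

lemma scalarVal_le (hτ : 0 < τ) (hβ : 0 < β) (hlam : 0 ≤ lam) {h x : ℝ} (hx : |x| ≤ A) :
    scalarVal τ β lam A h ≤ scalarObj τ β lam h x := by
  refine csInf_le ⟨-(β * A * |h|), ?_⟩ ⟨x, abs_le.1 hx, rfl⟩
  rintro _ ⟨y, hy, rfl⟩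
  exact neg_le_scalarObj hτ hβ hlam (abs_le.2 hy)

lemma abs_scalarVal_le (hτ : 0 < τ) (hβ : 0 < β) (hlam : 0 ≤ lam) (hA : 0 < A) (h : ℝ) :
    |scalarVal τ β lam A h| ≤ β * A * |h| := by
  rw [abs_le]
  constructor
  · refine le_csInf ⟨_, 0, ⟨by linarith, hA.le⟩, rfl⟩ ?_
    rintro _ ⟨y, hy, rfl⟩
    exact neg_le_scalarObj hτ hβ hlam (abs_le.2 hy)
  · have h0 := scalarVal_le hτ hβ hlam (h := h) (x := 0) (A := A) (by simpa using hA.le)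
    refine h0.trans ?_
    simp only [scalarObj]
    have : 0 ≤ β * A * |h| := by positivity
    simpa using this

lemma continuous_scalarVal (hτ : 0 < τ) (hβ : 0 < β) (hlam : 0 ≤ lam) (hA : 0 < A) :
    Continuous (scalarVal τ β lam A) := by
  refine (LipschitzWith.of_le_add_mul' (β * A) fun h h' => ?_).continuous
  rw [← sub_le_iff_le_add]
  refine le_csInf ⟨_, 0, ⟨by linarith, hA.le⟩, rfl⟩ ?_
  rintro _ ⟨y, hy, rfl⟩
  have hy' := abs_le.2 hy
  have h1 := scalarVal_le hτ hβ hlam (h := h) hy'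
  have h2 : (h' - h) * y ≤ A * dist h h' := by
    rw [dist_comm, dist_eq, mul_comm A]
    refine (le_abs_self _).trans ?_
    rw [abs_mul]
    gcongr
  simp only [scalarObj] at h1 ⊢
  nlinarith

lemma scalarVal_add_le (hτ : 0 < τ) (hβ : 0 < β) (hlam : 0 ≤ lam) {l r d : ℝ} (hd : 0 ≤ d)
    (hl : -A ≤ l) (hr : r ≤ A) {h x : ℝ}
    (hh : β * h / (2 * (β / (2 * τ) + lam)) ∈ Set.Ioo (l + d) (r - d)) (hx : x ∉ Set.Ioo l r) :
    scalarVal τ β lam A h + (β / (2 * τ) + lam) * d ^ 2 ≤ scalarObj τ β lam h x := by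
  have ha : 0 < β / (2 * τ) + lam := by positivity
  set a := β / (2 * τ) + lam with hadef
  set y := β * h / (2 * a) with hy
  have hβh : β * h = 2 * a * y := by rw [hy]; field_simp
  have hyA : |y| ≤ A := abs_le.2 ⟨by linarith [hh.1], by linarith [hh.2]⟩
  have h1 := scalarVal_le hτ hβ hlam (h := h) hyA
  have hobj : ∀ z, scalarObj τ β lam h z = a * (z - y) ^ 2 - a * y ^ 2 := fun z => by
    rw [scalarObj, hβh, hadef]; ring
  rw [hobj] at h1 ⊢
  have h2 : d ^ 2 ≤ (x - y) ^ 2 := by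
    rw [Set.mem_Ioo, not_and_or, not_lt, not_lt] at hx
    rcases hx with hx | hx
    · nlinarith [hh.1]
    · nlinarith [hh.2]
  nlinarith

/-- Vectors in the box with few entries in a subinterval lose a fixed amount in the separable
objective. -/
lemma exists_expSmall_sum_scalarObj_le (δ : ℝ) (hτ : 0 < τ) (hβ : 0 < β) (hlam : 0 ≤ lam)
    (hA : 0 < A) {l r : ℝ} (hl : -A ≤ l) (hlr : l < r) (hr : r ≤ A) :
    ∃ κ > 0, ∃ C₀ > 0, ExpSmall δ fun _ n => {p | ∃ x : Fin n → ℝ, (∀ j, |x j| ≤ A) ∧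
      (Set.ncard {j | x j ∈ Set.Ioo l r} : ℝ) < C₀ * n ∧
      ∑ j, scalarObj τ β lam (p.2 j) (x j) ≤
        n * (∫ h, scalarVal τ β lam A h ∂(gaussianReal 0 1) + κ)} := by
  set a := β / (2 * τ) + lam with ha
  have ha0 : 0 < a := by positivity
  set d := (r - l) / 3 with hd
  have hd0 : 0 < d := by rw [hd]; linarith
  set B := {h : ℝ | β * h / (2 * a) ∈ Set.Ioo (l + d) (r - d)} with hB
  have hBo : IsOpen B := isOpen_Ioo.preimage (by fun_prop)
  have hBne : B.Nonempty := by
    refine ⟨2 * a * ((l + r) / 2) / β, ?_⟩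
    have : β * (2 * a * ((l + r) / 2) / β) / (2 * a) = (l + r) / 2 := by field_simp
    rw [hB, Set.mem_ofPred_eq, this, hd]
    constructor <;> linarith
  set p := (gaussianReal 0 1).real B with hp
  have hp0 : 0 < p := by
    rw [hp, measureReal_def, ENNReal.toReal_pos_iff]
    refine ⟨pos_iff_ne_zero.2 fun h => ?_, measure_lt_top _ _⟩
    exact (hBo.measure_pos volume hBne).ne'
      (gaussianReal_absolutelyContinuous' 0 one_ne_zero h)
  set κ := a * d ^ 2 with hκ
  have hκ0 : 0 < κ := by positivity
  set Y : ℝ → ℝ := fun h => scalarVal τ β lam A h + B.indicator (fun _ => κ) h with hY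
  have hYm : Measurable Y :=
    (continuous_scalarVal hτ hβ hlam hA).measurable.add
      (measurable_const.indicator hBo.measurableSet)
  have habs : ∀ h : ℝ, |h| ≤ 1 + h ^ 2 := fun h => by
    nlinarith [sq_nonneg (|h| - 1), sq_abs h, sq_nonneg h]
  have hVb : ∀ h, |scalarVal τ β lam A h| ≤ β * A * (1 + h ^ 2) := fun h =>
    (abs_scalarVal_le hτ hβ hlam hA h).trans
      (mul_le_mul_of_nonneg_left (habs h) (by positivity))
  have hYb : ∀ h, |Y h| ≤ (β * A + κ) * (1 + h ^ 2) := fun h => by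
    refine (abs_add_le _ _).trans ?_
    rw [add_mul]
    refine add_le_add (hVb h) ?_
    refine (?_ : _ ≤ κ).trans (by nlinarith [sq_nonneg h])
    by_cases hh : h ∈ B
    · rw [Set.indicator_of_mem hh, abs_of_pos hκ0]
    · rw [Set.indicator_of_notMem hh, abs_zero]; exact hκ0.le
  have hVint := integrable_gaussianReal_of_abs_le (continuous_scalarVal hτ hβ hlam hA).measurable
    hVb
  have hYint : ∫ h, Y h ∂(gaussianReal 0 1) =
      ∫ h, scalarVal τ β lam A h ∂(gaussianReal 0 1) + κ * p := by
    rw [hY, integral_add hVint ((integrable_const κ).indicator hBo.measurableSet),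
      integral_indicator hBo.measurableSet]
    simp [hp, mul_comm]
  refine ⟨κ * p / 2, by positivity, p / 4, by positivity, ?_⟩
  refine (expSmall_sum_snd_le hYm hYb
    (b := ∫ h, scalarVal τ β lam A h ∂(gaussianReal 0 1) + κ * p - κ * p / 4)
    (by rw [hYint]; linarith [mul_pos hκ0 hp0])).mono ?_
  rintro m n hn - q ⟨x, hxA, hxI, hobj⟩
  have hI : (Set.ncard {j | x j ∈ Set.Ioo l r} : ℝ) =
      ∑ j, if x j ∈ Set.Ioo l r then (1 : ℝ) else 0 := by
    classical
    rw [Finset.sum_boole, ← Set.ncard_coe_finset]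
    simp
  have hle : ∑ j, Y (q.2 j) ≤ ∑ j, scalarObj τ β lam (q.2 j) (x j) +
      κ * Set.ncard {j | x j ∈ Set.Ioo l r} := by
    rw [hI, Finset.mul_sum, ← Finset.sum_add_distrib]
    refine Finset.sum_le_sum fun j _ => ?_
    have h1 := scalarVal_le hτ hβ hlam (h := q.2 j) (hxA j)
    simp only [hY]
    by_cases hh : q.2 j ∈ B
    · rw [Set.indicator_of_mem hh]
      split_ifs with hxj
      · linarith
      · have := scalarVal_add_le hτ hβ hlam hd0.le hl hr hh hxj
        rw [← ha, ← hκ] at this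
        linarith
    · rw [Set.indicator_of_notMem hh]
      split_ifs <;> linarith
  have h3 := mul_lt_mul_of_pos_left hxI hκ0
  simp only [Set.mem_ofPred_eq]
  linarith

end ScalarProblem

section Decoupled

/-- The decoupled cost at fixed dual variable `β`. -/
noncomputable def decoupledCost (β lam : ℝ) {m n : ℕ} (p : (Fin m → ℝ) × (Fin n → ℝ))
    (x : Fin n → ℝ) : ℝ :=
  β * (√(∑ k, (rms x * p.1 k - 1) ^ 2) / √n - (∑ j, p.2 j * x j) / n) - β ^ 2 / 4 +
    lam * rms x ^ 2

/-- Configurations for which the decoupled cost gets below `v` on box vectors with fewer than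
`C₀ n` entries in `(l, r)` and normalized norm in `U`. -/
def decoupledEvent (β lam A l r C₀ v : ℝ) (U : Set ℝ) (m n : ℕ) :
    Set ((Fin m → ℝ) × (Fin n → ℝ)) :=
  {p | ∃ x : Fin n → ℝ, (∀ j, |x j| ≤ A) ∧
    (Set.ncard {j | x j ∈ Set.Ioo l r} : ℝ) < C₀ * n ∧ rms x ∈ U ∧ decoupledCost β lam p x < v}

lemma decoupledEvent_mono {β lam A l r C₀ C₀' v v' : ℝ} {U U' : Set ℝ} (hC : C₀ ≤ C₀')
    (hv : v ≤ v') (hU : U ⊆ U') (m n : ℕ) :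
    decoupledEvent β lam A l r C₀ v U m n ⊆ decoupledEvent β lam A l r C₀' v' U' m n := by
  rintro p ⟨x, h1, h2, h3, h4⟩
  exact ⟨x, h1, h2.trans_le (by gcongr), hU h3, h4.trans_le hv⟩

lemma rms_le {n : ℕ} {x : Fin n → ℝ} {A : ℝ} (hA : 0 ≤ A) (hx : ∀ j, |x j| ≤ A) : rms x ≤ A := by
  refine sqrt_le_iff.2 ⟨hA, ?_⟩
  rcases n.eq_zero_or_pos with rfl | hn
  · simpa using sq_nonneg A
  · rw [div_le_iff₀ (Nat.cast_pos.2 hn)]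
    calc ∑ j, x j ^ 2 ≤ ∑ _j : Fin n, A ^ 2 :=
          Finset.sum_le_sum fun j _ => sq_le_sq' (abs_le.1 (hx j)).1 (abs_le.1 (hx j)).2
      _ = A ^ 2 * n := by simp [mul_comm]

variable {δ lam A β φ₀ l r : ℝ}

lemma exists_expSmall_decoupledEvent_nhds (hδ : 0 < δ) (hlam : 0 ≤ lam) (hA : 0 < A) (hβ : 0 < β)
    (hφ : ∀ τ : ℝ, 0 < τ → φ₀ ≤ phiFn δ lam 1 A τ β)
    (hl : -A ≤ l) (hlr : l < r) (hr : r ≤ A) (σ₀ : ℝ) :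
    ∃ K > 0, ∃ C₀ > 0, ∃ U ∈ nhds σ₀,
      ExpSmall δ (decoupledEvent β lam A l r C₀ (φ₀ + K) U) := by
  set τ := √((σ₀ ^ 2 + 1) / δ) with hτdef
  have hτ : 0 < τ := sqrt_pos.2 (by positivity)
  have hτ2 : δ * τ ^ 2 = σ₀ ^ 2 + 1 := by
    rw [hτdef, sq_sqrt (by positivity)]; field_simp
  set ψ : ℝ → ℝ := fun σ => β * √(δ * (σ ^ 2 + 1)) - β / (2 * τ) * σ ^ 2 with hψ
  have hψc : Continuous ψ := by simp only [hψ]; fun_prop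
  have hψ₀ : ψ σ₀ = τ * β * δ / 2 + 1 * β / (2 * τ) := by
    have h1 : √(δ * (σ₀ ^ 2 + 1)) = δ * τ := by
      rw [← hτ2, show δ * (δ * τ ^ 2) = (δ * τ) ^ 2 by ring, sqrt_sq (by positivity)]
    have h2 : σ₀ ^ 2 = δ * τ ^ 2 - 1 := by linarith
    simp only [hψ]
    rw [h1, h2]
    field_simp
    ring
  obtain ⟨κ, hκ, C₀, hC₀, hsmall⟩ := exists_expSmall_sum_scalarObj_le δ hτ hβ hlam hA hl hlr hr
  have hg := expSmall_dist_lt hδ hA (η := κ / (4 * β)) (by positivity)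
  have hU : {σ | ψ σ₀ - κ / 4 < ψ σ} ∈ nhds σ₀ :=
    hψc.continuousAt.preimage_mem_nhds (Ioi_mem_nhds (by linarith))
  refine ⟨κ / 2, by positivity, C₀, hC₀, _, hU, (hsmall.union hg).mono ?_⟩
  rintro m n hn - p ⟨x, hxA, hxI, hxU, hcost⟩
  have hn' : (0 : ℝ) < n := Nat.cast_pos.2 hn
  by_contra hcon
  rw [Set.mem_union, not_or] at hcon
  obtain ⟨hc1, hc2⟩ := hcon
  have h1 : n * (∫ h, scalarVal τ β lam A h ∂(gaussianReal 0 1) + κ) <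
      ∑ j, scalarObj τ β lam (p.2 j) (x j) := by
    by_contra! h
    exact hc1 ⟨x, hxA, hxI, h⟩
  have h2 : √(δ * (rms x ^ 2 + 1)) - κ / (4 * β) ≤
      √(∑ k, (rms x * p.1 k - 1) ^ 2) / √n := by
    by_contra! h
    exact hc2 ⟨rms x, rms_nonneg x, rms_le hA.le hxA, h⟩
  have h3 := hφ τ hτ
  have h4 : phiFn δ lam 1 A τ β = τ * β * δ / 2 + 1 * β / (2 * τ) - β ^ 2 / 4 +
    ∫ h, scalarVal τ β lam A h ∂(gaussianReal 0 1) := rfl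
  have h5 : ∑ j, scalarObj τ β lam (p.2 j) (x j) =
      n * ((β / (2 * τ) + lam) * rms x ^ 2 - β * ((∑ j, p.2 j * x j) / n)) := by
    rw [rms_sq]
    simp only [scalarObj, Finset.sum_add_distrib, Finset.sum_sub_distrib, ← Finset.mul_sum,
      mul_assoc]
    field_simp
  rw [h5] at h1
  have h6 := lt_of_mul_lt_mul_left h1 hn'.le
  have h7 := mul_le_mul_of_nonneg_left h2 hβ.le
  have h8 : β * (κ / (4 * β)) = κ / 4 := by field_simp
  have h9 : ψ σ₀ - κ / 4 < β * √(δ * (rms x ^ 2 + 1)) - β / (2 * τ) * rms x ^ 2 := hxU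
  rw [mul_sub, h8] at h7
  unfold decoupledCost at hcost
  rw [mul_sub β (_ / _)] at hcost
  linarith

lemma exists_expSmall_decoupledEvent (hδ : 0 < δ) (hlam : 0 ≤ lam) (hA : 0 < A) (hβ : 0 < β)
    (hφ : ∀ τ : ℝ, 0 < τ → φ₀ ≤ phiFn δ lam 1 A τ β)
    (hl : -A ≤ l) (hlr : l < r) (hr : r ≤ A) :
    ∃ K > 0, ∃ C₀ > 0,
      ExpSmall δ (decoupledEvent β lam A l r C₀ (φ₀ + K) (Set.Icc 0 A)) := by
  refine (isCompact_Icc (a := (0 : ℝ)) (b := A)).induction_on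
    (p := fun U => ∃ K > 0, ∃ C₀ > 0, ExpSmall δ (decoupledEvent β lam A l r C₀ (φ₀ + K) U))
    ⟨1, one_pos, 1, one_pos, expSmall_empty.mono ?_⟩ ?_ ?_ ?_
  · rintro m n - - p ⟨x, -, -, h, -⟩
    exact h.elim
  · rintro U V hUV ⟨K, hK, C₀, hC₀, h⟩
    exact ⟨K, hK, C₀, hC₀, h.mono fun m n _ _ => decoupledEvent_mono le_rfl le_rfl hUV m n⟩
  · rintro U V ⟨K, hK, C₀, hC₀, h⟩ ⟨K', hK', C₀', hC₀', h'⟩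
    refine ⟨min K K', lt_min hK hK', min C₀ C₀', lt_min hC₀ hC₀', (h.union h').mono ?_⟩
    rintro m n - - p ⟨x, h1, h2, h3, h4⟩
    rcases h3 with h3 | h3
    · exact Or.inl (decoupledEvent_mono (min_le_left _ _)
        (by linarith [min_le_left K K']) subset_rfl m n ⟨x, h1, h2, h3, h4⟩)
    · exact Or.inr (decoupledEvent_mono (min_le_right _ _)
        (by linarith [min_le_right K K']) subset_rfl m n ⟨x, h1, h2, h3, h4⟩)
  · intro σ₀ _
    obtain ⟨K, hK, C₀, hC₀, U, hU, h⟩ :=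
      exists_expSmall_decoupledEvent_nhds hδ hlam hA hβ hφ hl hlr hr σ₀
    exact ⟨U, mem_nhdsWithin_of_mem_nhds hU, K, hK, C₀, hC₀, h⟩

end Decoupled

section Main

instance isProbabilityMeasure_matMeasure (m n : ℕ) : IsProbabilityMeasure (matMeasure m n) := by
  unfold matMeasure; infer_instance

/-- Matrices for which some box vector with fewer than `C₀ n` entries in `(l, r)` has cost at most
`v`. -/
def sparseEvent (lam A l r C₀ v : ℝ) {m : ℕ} (n : ℕ) (s : Fin m → ℝ) :
    Set (Fin m → Fin n → ℝ) :=
  {H | ∃ x : Fin n → ℝ, (∀ i, |x i| ≤ A) ∧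
    (Set.ncard {i | x i ∈ Set.Ioo l r} : ℝ) < C₀ * n ∧ cost1 m n lam s H x ≤ v}

lemma cost1_eq (m n : ℕ) (lam : ℝ) (s : Fin m → ℝ) (H : Fin m → Fin n → ℝ) (x : Fin n → ℝ) :
    cost1 m n lam s H x = (∑ k, (mulV H x k - s k) ^ 2) / n + lam * rms x ^ 2 := by
  rw [cost1, rms_sq, mul_div_assoc]

variable {δ lam A β φ₀ l r : ℝ}

lemma matMeasure_sparseEvent_le {m n : ℕ} (hn : 0 < n) (hA : 0 ≤ A)
    (hβ : 0 < β) {C₀ v v' : ℝ} (hv : v < v') {s : Fin m → ℝ} (hs : ∀ k, s k = 1 ∨ s k = -1) :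
    matMeasure m n (sparseEvent lam A l r C₀ v n s) ≤ ENNReal.ofReal
      (4 * ((gaussPi (Fin m)).prod (gaussPi (Fin n))).real
        (decoupledEvent β lam A l r C₀ v' (Set.Icc 0 A) m n)) := by
  have hn' : (0 : ℝ) < n := Nat.cast_pos.2 hn
  obtain ⟨w, hvw, hwv⟩ := exists_between hv
  set S := {x : Fin n → ℝ | (∀ j, |x j| ≤ A) ∧
    (Set.ncard {j | x j ∈ Set.Ioo l r} : ℝ) < C₀ * n ∧ lam * rms x ^ 2 ≤ w} with hS
  obtain ⟨D, hDS, hDc, hSD⟩ :=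
    (TopologicalSpace.IsSeparable.of_separableSpace S).exists_countable_dense_subset
  have hsub : sparseEvent lam A l r C₀ v n s ⊆ {H | ∃ x ∈ D, cost1 m n lam s H x < w} := by
    rintro H ⟨x, hxA, hxI, hcost⟩
    have hxS : x ∈ S := by
      refine ⟨hxA, hxI, ?_⟩
      rw [cost1_eq] at hcost
      have : 0 ≤ (∑ k, (mulV H x k - s k) ^ 2) / n :=
        div_nonneg (Finset.sum_nonneg fun _ _ => sq_nonneg _) hn'.le
      linarith
    have hopen : IsOpen {y | cost1 m n lam s H y < w} := by
      refine isOpen_lt ?_ continuous_const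
      unfold cost1 mulV
      fun_prop
    obtain ⟨y, hy, hyD⟩ := mem_closure_iff.1 (hSD hxS) _ hopen (hcost.trans_lt hvw)
    exact ⟨y, hyD, hy⟩
  refine (measure_mono hsub).trans ?_
  rcases D.eq_empty_or_nonempty with hD | hD
  · simp [hD]
  obtain ⟨f, rfl⟩ := hDc.exists_eq_range hD
  have hU : {H | ∃ x ∈ Set.range f, cost1 m n lam s H x < w} =
      ⋃ N : ℕ, {H | ∃ i : Fin N, cost1 m n lam s H (f i) < w} := by
    ext H
    simp only [Set.exists_range_iff, Set.mem_iUnion, Set.mem_ofPred_eq]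
    exact ⟨fun ⟨i, hi⟩ => ⟨i + 1, ⟨i, i.lt_succ_self⟩, hi⟩, fun ⟨_, i, hi⟩ => ⟨i, hi⟩⟩
  have hmono : Monotone fun N : ℕ => {H | ∃ i : Fin N, cost1 m n lam s H (f i) < w} := by
    rintro N N' hN H ⟨i, hi⟩
    exact ⟨Fin.castLE hN i, hi⟩
  rw [hU, hmono.measure_iUnion]
  refine iSup_le fun N => ?_
  rw [← ofReal_measureReal]
  refine ENNReal.ofReal_le_ofReal ?_
  set η := (v' - w) / (2 * β) with hη
  have hη0 : 0 < η := div_pos (by linarith) (by linarith)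
  have hηβ : β * (2 * η) = v' - w := by rw [hη]; field_simp
  have ht : ∀ i : Fin N, 0 ≤ w - lam * rms (f i) ^ 2 := fun i =>
    sub_nonneg.2 (hDS ⟨i, rfl⟩).2.2
  have hG := matMeasure_exists_dist_le hn hs (fun i : Fin N => f i)
    (fun i => √(w - lam * rms (f i) ^ 2)) hη0
  refine (measureReal_mono ?_).trans (hG.trans (mul_le_mul_of_nonneg_left
    (measureReal_mono ?_) (by norm_num)))
  · rintro H ⟨i, hi⟩
    refine ⟨i, ?_⟩
    rw [← sqrt_mul n.cast_nonneg]
    refine sqrt_le_sqrt ?_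
    rw [cost1_eq, ← lt_sub_iff_add_lt, div_lt_iff₀ hn'] at hi
    linarith
  · rintro p ⟨i, hi⟩
    obtain ⟨hfA, hfI, -⟩ := hDS ⟨i, rfl⟩
    refine ⟨f i, hfA, hfI, ⟨rms_nonneg _, rms_le hA hfA⟩, ?_⟩
    have h1 := mul_lt_mul_of_pos_left hi hβ
    have h2 := sq_sqrt (ht i)
    unfold decoupledCost
    nlinarith [sq_nonneg (√(w - lam * rms (f i) ^ 2) - β / 2)]

lemma exists_matMeasure_sparseEvent_le (hδ : 0 < δ) (hlam : 0 ≤ lam) (hA : 0 < A) (hβ : 0 < β)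
    (hφ : ∀ τ : ℝ, 0 < τ → φ₀ ≤ phiFn δ lam 1 A τ β)
    (hl : -A ≤ l) (hlr : l < r) (hr : r ≤ A) :
    ∃ K > 0, ∃ C₀ > 0, ∃ C ≥ 0, ∃ c > 0, ∀ n m : ℕ, (m : ℝ) = δ * n →
      ∀ s : Fin m → ℝ, (∀ k, s k = 1 ∨ s k = -1) →
        matMeasure m n (sparseEvent lam A l r C₀ (φ₀ + K) n s) ≤
          ENNReal.ofReal (C * exp (-(c * n))) := by
  obtain ⟨K, hK, C₀, hC₀, C, c, hC, hc, h⟩ :=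
    exists_expSmall_decoupledEvent hδ hlam hA hβ hφ hl hlr hr
  refine ⟨K / 2, by positivity, C₀, hC₀, 4 * C, by positivity, c, hc, fun n m hm s hs => ?_⟩
  rcases n.eq_zero_or_pos with rfl | hn
  · have : sparseEvent lam A l r C₀ (φ₀ + K / 2) 0 s = ∅ := by
      refine Set.eq_empty_of_forall_notMem ?_
      rintro H ⟨x, -, hx, -⟩
      simp only [Nat.cast_zero, mul_zero] at hx
      exact absurd hx (not_lt.2 (Nat.cast_nonneg _))
    simp [this]
  · refine (matMeasure_sparseEvent_le hn hA.le hβ (v' := φ₀ + K) (by linarith) hs).trans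
      (ENNReal.ofReal_le_ofReal ?_)
    rw [mul_assoc]
    exact mul_le_mul_of_nonneg_left (h n m hn hm) (by norm_num)

lemma sparseEvent_mono {C₀ C₀' v v' : ℝ} (hC : C₀ ≤ C₀') (hv : v ≤ v') {m n : ℕ}
    (s : Fin m → ℝ) :
    sparseEvent lam A l r C₀ v n s ⊆ sparseEvent lam A l r C₀' v' n s := by
  rintro H ⟨x, h1, h2, h3⟩
  exact ⟨x, h1, h2.trans_le (by gcongr), h3.trans hv⟩

end Main

/-- box-constrained vectors with fewer than `C₀ n` entries in one of the four
reference intervals cannot achieve a cost within `γ ε³` of the optimum, except with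
probability at most `(C/ε³) e^{−c n ε⁶}`.  The event `min ≤ t` over the constrained
(possibly empty, in which case the min is `+∞`) set is expressed as
`∃ x` feasible with `P(x; 1) ≤ t`. -/
theorem stmt18 (δ lam A : ℝ) (hδ : 0 < δ) (hlam : 0 ≤ lam) (hA : 0 < A)
    (hcond : 0 < lam ∨ (lam = 0 ∧ 1 ≤ δ))
    (τs βs : ℝ) (hsaddle : IsSaddle δ lam 1 A τs βs) :
    ∃ C₀ C c γ ε₀ : ℝ, 0 < C₀ ∧ 0 < C ∧ 0 < c ∧ 0 < γ ∧ 0 < ε₀ ∧ ε₀ < 1 ∧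
      ∀ (n m : ℕ), (m : ℝ) = δ * n →
        ∀ s : Fin m → ℝ, (∀ k, s k = 1 ∨ s k = -1) →
          ∀ ε : ℝ, 0 < ε → ε < ε₀ →
            matMeasure m n
                {H : Fin m → Fin n → ℝ | ∃ x : Fin n → ℝ,
                  (∀ i, |x i| ≤ A) ∧
                  (((Set.ncard {i : Fin n |
                        x i ∈ Set.Ioo (-(4 * A / 5)) (-(3 * A / 5))} : ℝ) < C₀ * n) ∨
                    ((Set.ncard {i : Fin n |
                        x i ∈ Set.Ioo (-(2 * A / 5)) (-(A / 5))} : ℝ) < C₀ * n) ∨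
                    ((Set.ncard {i : Fin n |
                        x i ∈ Set.Ioo (A / 5) (2 * A / 5)} : ℝ) < C₀ * n) ∨
                    ((Set.ncard {i : Fin n |
                        x i ∈ Set.Ioo (3 * A / 5) (4 * A / 5)} : ℝ) < C₀ * n)) ∧
                  cost1 m n lam s H x ≤ phiFn δ lam 1 A τs βs + γ * ε ^ 3} ≤
              ENNReal.ofReal (C / ε ^ 3 * Real.exp (-c * n * ε ^ 6)) := by
  obtain ⟨-, hβ, hφ, -⟩ := hsaddle
  set φ₀ := phiFn δ lam 1 A τs βs
  obtain ⟨K₁, hK₁, D₁, hD₁, C₁, hC₁, c₁, hc₁, h₁⟩ := exists_matMeasure_sparseEvent_le hδ hlam hA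
    hβ hφ (l := -(4 * A / 5)) (r := -(3 * A / 5)) (by linarith) (by linarith) (by linarith)
  obtain ⟨K₂, hK₂, D₂, hD₂, C₂, hC₂, c₂, hc₂, h₂⟩ := exists_matMeasure_sparseEvent_le hδ hlam hA
    hβ hφ (l := -(2 * A / 5)) (r := -(A / 5)) (by linarith) (by linarith) (by linarith)
  obtain ⟨K₃, hK₃, D₃, hD₃, C₃, hC₃, c₃, hc₃, h₃⟩ := exists_matMeasure_sparseEvent_le hδ hlam hA
    hβ hφ (l := A / 5) (r := 2 * A / 5) (by linarith) (by linarith) (by linarith)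
  obtain ⟨K₄, hK₄, D₄, hD₄, C₄, hC₄, c₄, hc₄, h₄⟩ := exists_matMeasure_sparseEvent_le hδ hlam hA
    hβ hφ (l := 3 * A / 5) (r := 4 * A / 5) (by linarith) (by linarith) (by linarith)
  refine ⟨min (min D₁ D₂) (min D₃ D₄), C₁ + C₂ + C₃ + C₄ + 1, min (min c₁ c₂) (min c₃ c₄),
    min (min K₁ K₂) (min K₃ K₄), 1 / 2, by positivity, by positivity, by positivity, by positivity,
    by norm_num, by norm_num, fun n m hm s hs ε hε hε₀ => ?_⟩
  set D := min (min D₁ D₂) (min D₃ D₄)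
  set K := min (min K₁ K₂) (min K₃ K₄)
  set c := min (min c₁ c₂) (min c₃ c₄)
  have hK : 0 < K := by positivity
  have hc : 0 < c := by positivity
  have hε3 : ε ^ 3 ≤ 1 := pow_le_one₀ hε.le (by linarith)
  have hε6 : ε ^ 6 ≤ 1 := pow_le_one₀ hε.le (by linarith)
  have hKε : K * ε ^ 3 ≤ K := mul_le_of_le_one_right hK.le hε3
  set q := exp (-c * n * ε ^ 6) with hq
  have hbound : ∀ {C c' : ℝ}, 0 ≤ C → c ≤ c' → C * exp (-(c' * n)) ≤ C * q := by
    intro C c' hC hcc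
    refine mul_le_mul_of_nonneg_left (exp_le_exp.2 ?_) hC
    have h1 : c * n * ε ^ 6 ≤ c * n := mul_le_of_le_one_right (by positivity) hε6
    have h2 : c * n ≤ c' * n := by gcongr
    linarith
  have hfin : ∀ {l r D' K' C c' : ℝ}, 0 ≤ C → c ≤ c' → D ≤ D' → K ≤ K' →
      matMeasure m n (sparseEvent lam A l r D' (φ₀ + K') n s) ≤
        ENNReal.ofReal (C * exp (-(c' * n))) →
      matMeasure m n (sparseEvent lam A l r D (φ₀ + K * ε ^ 3) n s) ≤ ENNReal.ofReal (C * q) :=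
    fun hC hc hD hK h => (measure_mono (sparseEvent_mono hD (by linarith) s)).trans
      (h.trans (ENNReal.ofReal_le_ofReal (hbound hC hc)))
  have e₁ := hfin hC₁ ((min_le_left _ _).trans (min_le_left _ _))
    ((min_le_left _ _).trans (min_le_left _ _)) ((min_le_left _ _).trans (min_le_left _ _))
    (h₁ n m hm s hs)
  have e₂ := hfin hC₂ ((min_le_left _ _).trans (min_le_right _ _))
    ((min_le_left _ _).trans (min_le_right _ _)) ((min_le_left _ _).trans (min_le_right _ _))
    (h₂ n m hm s hs)
  have e₃ := hfin hC₃ ((min_le_right _ _).trans (min_le_left _ _))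
    ((min_le_right _ _).trans (min_le_left _ _)) ((min_le_right _ _).trans (min_le_left _ _))
    (h₃ n m hm s hs)
  have e₄ := hfin hC₄ ((min_le_right _ _).trans (min_le_right _ _))
    ((min_le_right _ _).trans (min_le_right _ _)) ((min_le_right _ _).trans (min_le_right _ _))
    (h₄ n m hm s hs)
  have hsub : {H : Fin m → Fin n → ℝ | ∃ x : Fin n → ℝ, (∀ i, |x i| ≤ A) ∧
      (((Set.ncard {i : Fin n | x i ∈ Set.Ioo (-(4 * A / 5)) (-(3 * A / 5))} : ℝ) < D * n) ∨
        ((Set.ncard {i : Fin n | x i ∈ Set.Ioo (-(2 * A / 5)) (-(A / 5))} : ℝ) < D * n) ∨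
        ((Set.ncard {i : Fin n | x i ∈ Set.Ioo (A / 5) (2 * A / 5)} : ℝ) < D * n) ∨
        ((Set.ncard {i : Fin n | x i ∈ Set.Ioo (3 * A / 5) (4 * A / 5)} : ℝ) < D * n)) ∧
      cost1 m n lam s H x ≤ φ₀ + K * ε ^ 3} ⊆
      ((sparseEvent lam A (-(4 * A / 5)) (-(3 * A / 5)) D (φ₀ + K * ε ^ 3) n s ∪
        sparseEvent lam A (-(2 * A / 5)) (-(A / 5)) D (φ₀ + K * ε ^ 3) n s) ∪
        sparseEvent lam A (A / 5) (2 * A / 5) D (φ₀ + K * ε ^ 3) n s) ∪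
        sparseEvent lam A (3 * A / 5) (4 * A / 5) D (φ₀ + K * ε ^ 3) n s := by
    rintro H ⟨x, hxA, hx | hx | hx | hx, hcost⟩
    · exact Or.inl (Or.inl (Or.inl ⟨x, hxA, hx, hcost⟩))
    · exact Or.inl (Or.inl (Or.inr ⟨x, hxA, hx, hcost⟩))
    · exact Or.inl (Or.inr ⟨x, hxA, hx, hcost⟩)
    · exact Or.inr ⟨x, hxA, hx, hcost⟩
  refine (measure_mono hsub).trans ((measure_union_le _ _).trans ((add_le_add
    ((measure_union_le _ _).trans (add_le_add ((measure_union_le _ _).trans (add_le_add e₁ e₂))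
      e₃)) e₄).trans ?_))
  have hq0 : 0 < q := exp_pos _
  rw [← ENNReal.ofReal_add (by positivity) (by positivity),
    ← ENNReal.ofReal_add (by positivity) (by positivity),
    ← ENNReal.ofReal_add (by positivity) (by positivity)]
  refine ENNReal.ofReal_le_ofReal ?_
  rw [← add_mul, ← add_mul, ← add_mul]
  refine mul_le_mul_of_nonneg_right ?_ hq0.le
  rw [le_div_iff₀ (by positivity)]
  have : (C₁ + C₂ + C₃ + C₄) * ε ^ 3 ≤ C₁ + C₂ + C₃ + C₄ :=
    mul_le_of_le_one_right (by positivity) hε3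
  linarith
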